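/- Suppose that the obstacle h is continuous in Ω. Then the solution u to the obstacle problem in K_{g,h}(Ω,Ω') is continuous in Ω, i.e. u has a representative which is continuous on Ω. -/

import Mathlib

open MeasureTheory Metric Filter
open scoped ENNReal Topology

noncomputable section

/-- `ℝ^n`. -/
abbrev Euc (n : ℕ) := EuclideanSpace ℝ (Fin n)

/-- `L(a,b) = |a-b|^{p-2}(a-b)` (real powers; the convention `L(a,a)=0` holds automatically). -/
noncomputable def Lf (p a b : ℝ) : ℝ := |a - b| ^ (p - 2) * (a - b)

/-- A symmetric measurable kernel of order `(s,p)` with ellipticity constant `Λ`. -/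
def IsKernel (n : ℕ) (s p Λ : ℝ) (K : Euc n → Euc n → ℝ) : Prop :=
  Measurable (Function.uncurry K) ∧
  (∀ x y, K x y = K y x) ∧ (∀ x y, 0 ≤ K x y) ∧
  (∀ᵐ z : Euc n × Euc n, Λ⁻¹ ≤ K z.1 z.2 * ‖z.1 - z.2‖ ^ ((n : ℝ) + s * p) ∧
    K z.1 z.2 * ‖z.1 - z.2‖ ^ ((n : ℝ) + s * p) ≤ Λ)

/-- Membership in the fractional Sobolev space `W^{s,p}(D)` (finiteness of the norm). -/
def MemW (n : ℕ) (s p : ℝ) (D : Set (Euc n)) (v : Euc n → ℝ) : Prop :=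
  AEMeasurable v (volume.restrict D) ∧
  IntegrableOn (fun x => |v x| ^ p) D volume ∧
  Integrable (fun q : Euc n × Euc n => |v q.1 - v q.2| ^ p / ‖q.1 - q.2‖ ^ ((n : ℝ) + s * p))
    ((volume.restrict D).prod (volume.restrict D))

/-- The `W^{s,p}(D)` norm. -/
noncomputable def sobNorm (n : ℕ) (s p : ℝ) (D : Set (Euc n)) (v : Euc n → ℝ) : ℝ :=
  (∫ x in D, |v x| ^ p) ^ (1/p) +
  (∫ x in D, ∫ y in D, |v x - v y| ^ p / ‖x - y‖ ^ ((n : ℝ) + s * p)) ^ (1/p)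

/-- The nonlocal tail `Tail(f; z, r)`. -/
noncomputable def tailF (n : ℕ) (s p : ℝ) (f : Euc n → ℝ) (z : Euc n) (r : ℝ) : ℝ :=
  (r ^ (s * p) * ∫ x in (ball z r)ᶜ, |f x| ^ (p - 1) * ‖x - z‖ ^ (-((n : ℝ) + s * p))) ^ (1/(p-1))

/-- Membership in the tail space `L^{p-1}_{sp}(ℝ^n)`. -/
def MemTail (n : ℕ) (s p : ℝ) (f : Euc n → ℝ) : Prop :=
  AEMeasurable f volume ∧
  (∀ z : Euc n, ∀ r : ℝ, 0 < r → IntegrableOn (fun x => |f x| ^ (p - 1)) (ball z r) volume) ∧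
  (∀ z : Euc n, ∀ r : ℝ, 0 < r →
    IntegrableOn (fun x => |f x| ^ (p - 1) * ‖x - z‖ ^ (-((n : ℝ) + s * p))) (ball z r)ᶜ volume)

/-- The admissible class `K_{g,h}(Ω,Ω')`. -/
def obstacleSet (n : ℕ) (s p : ℝ) (Ω Ω' : Set (Euc n)) (g : Euc n → ℝ) (h : Euc n → EReal) :
    Set (Euc n → ℝ) :=
  {u | MemW n s p Ω' u ∧ (∀ᵐ x ∂(volume : Measure (Euc n)), x ∈ Ω → h x ≤ (u x : EReal)) ∧
    (∀ᵐ x ∂(volume : Measure (Euc n)), x ∉ Ω → u x = g x)}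

/-- The functional `A u (v)`. -/
noncomputable def Aop (n : ℕ) (p : ℝ) (Ω Ω' : Set (Euc n)) (g : Euc n → ℝ)
    (K : Euc n → Euc n → ℝ) (u v : Euc n → ℝ) : ℝ :=
  (∫ x in Ω', ∫ y in Ω', Lf p (u x) (u y) * (v x - v y) * K x y) +
  2 * ∫ y in Ω'ᶜ, ∫ x in Ω, Lf p (u x) (g y) * v x * K x y

/-- `u` solves the obstacle problem in `K_{g,h}(Ω,Ω')`. -/
def SolvesObstacle (n : ℕ) (s p : ℝ) (Ω Ω' : Set (Euc n)) (g : Euc n → ℝ) (h : Euc n → EReal)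
    (K : Euc n → Euc n → ℝ) (u : Euc n → ℝ) : Prop :=
  u ∈ obstacleSet n s p Ω Ω' g h ∧
  ∀ v ∈ obstacleSet n s p Ω Ω' g h, 0 ≤ Aop n p Ω Ω' g K u (fun x => v x - u x)

/-- The essential oscillation of `f` on `A` (in `EReal`). -/
noncomputable def essOsc (n : ℕ) (A : Set (Euc n)) (f : Euc n → ℝ) : EReal :=
  essSup (fun x => (f x : EReal)) (volume.restrict A) -
    essInf (fun x => (f x : EReal)) (volume.restrict A)

end



lemma Lf_neg (p a b : ℝ) : Lf p (-a) (-b) = - Lf p a b := by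
  unfold Lf
  have : -a - -b = -(a-b) := by ring
  rw [this, abs_neg]; ring

lemma Lf_swap (p a b : ℝ) : Lf p b a = - Lf p a b := by
  unfold Lf
  have : b - a = -(a-b) := by ring
  rw [this, abs_neg]; ring

lemma Lf_sub (p a b k : ℝ) : Lf p (a - k) (b - k) = Lf p a b := by
  unfold Lf
  have : a - k - (b - k) = a - b := by ring
  rw [this]

lemma Lf_of_le {p a b : ℝ} (hp : 1 < p) (h : b ≤ a) : Lf p a b = (a - b) ^ (p - 1) := by
  unfold Lf
  rcases h.eq_or_lt with rfl | h
  · simp [Real.zero_rpow (by linarith : p - 1 ≠ 0)]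
  · have h' : 0 < a - b := by linarith
    rw [abs_of_pos h']
    nth_rewrite 2 [← Real.rpow_one (a-b)]
    rw [← Real.rpow_add h']
    congr 1; ring

lemma abs_Lf {p a b : ℝ} (hp : 1 < p) : |Lf p a b| = |a - b| ^ (p - 1) := by
  rcases le_total b a with h | h
  · rw [Lf_of_le hp h, abs_of_nonneg (Real.rpow_nonneg (by linarith) _), abs_of_nonneg (by linarith : 0 ≤ a - b)]
  · rw [Lf_swap, Lf_of_le hp h, abs_neg, abs_of_nonneg (Real.rpow_nonneg (by linarith) _), abs_sub_comm, abs_of_nonneg (by linarith : 0 ≤ b - a)]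

lemma rpow_pm1_mul {p x : ℝ} (hp : 1 < p) (hx : 0 ≤ x) : x ^ (p - 1) * x = x ^ p := by
  rcases hx.eq_or_lt with rfl | h
  · simp [Real.zero_rpow (by linarith : p ≠ 0)]
  · nth_rewrite 2 [← Real.rpow_one x]
    rw [← Real.rpow_add h]; congr 1; ring

/-- `(a+b)^q ≤ 2^q (a^q+b^q)`. -/
lemma add_rpow_le_two {q a b : ℝ} (hq : 0 ≤ q) (ha : 0 ≤ a) (hb : 0 ≤ b) :
    (a + b) ^ q ≤ 2 ^ q * (a ^ q + b ^ q) := by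
  have h1 : 0 ≤ a ^ q := Real.rpow_nonneg ha _
  have h2 : 0 ≤ b ^ q := Real.rpow_nonneg hb _
  have h3 : (0:ℝ) ≤ 2 ^ q := by positivity
  rcases le_total a b with h | h
  · calc (a+b)^q ≤ (2*b)^q := Real.rpow_le_rpow (by linarith) (by linarith) hq
      _ = 2^q * b^q := Real.mul_rpow (by norm_num) hb
      _ ≤ _ := by nlinarith
  · calc (a+b)^q ≤ (2*a)^q := Real.rpow_le_rpow (by linarith) (by linarith) hq
      _ = 2^q * a^q := Real.mul_rpow (by norm_num) ha
      _ ≤ _ := by nlinarith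

lemma rpow_sub_le {p α β : ℝ} (hp : 1 < p) (hα : 0 ≤ α) (hαβ : α ≤ β) :
    β ^ p - α ^ p ≤ p * β ^ (p - 1) * (β - α) := by
  rcases hα.trans hαβ |>.eq_or_lt with h | h
  · have : α = 0 := by linarith
    subst this; subst h; simp
  · have hb := one_add_mul_self_le_rpow_one_add (s := α/β - 1) (p := p) (by
      have : 0 ≤ α/β := by positivity
      linarith) hp.le
    have e1 : 1 + (α/β - 1) = α/β := by ring
    rw [e1, Real.div_rpow hα h.le] at hb
    have hpos : 0 < β^p := by positivity
    have e2 : β^p * (α^p/β^p) = α^p := by field_simp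
    have e3 : β^p = β^(p-1) * β := (rpow_pm1_mul hp h.le).symm
    have e4 : β ^ p * (1 + p * (α/β - 1)) ≤ α^p := by
      rw [← e2]; exact mul_le_mul_of_nonneg_left hb hpos.le
    have e5 : β ^ p * (1 + p * (α/β - 1)) = β^p - p * β^(p-1) * (β - α) := by
      rw [e3]; field_simp; ring
    linarith

/-- the half case `0 ≤ b ≤ a` -/
lemma alg_pos {p : ℝ} (hp : 1 < p) {a b α β : ℝ} (hb : 0 ≤ b) (hab : b ≤ a) (hα : 0 ≤ α) (hβ : 0 ≤ β) :
    |α * a - β * b| ^ p ≤ 2 ^ p * 2 * ((a - b) ^ (p-1) * (α ^ p * a - β ^ p * b))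
      + 2 ^ p * (1 + 2 * p * (2 * p) ^ (p-1)) * ((a ^ p + b ^ p) * |α - β| ^ p) := by
  have ha : 0 ≤ a := hb.trans hab
  have hd : 0 ≤ a - b := by linarith
  set C1 : ℝ := 2 * p * (2 * p) ^ (p-1) with hC1
  have hC1n : 0 ≤ C1 := by positivity
  have h2p : (0:ℝ) < 2 ^ p := by positivity
  have hap : 0 ≤ a ^ p := by positivity
  have hbp : 0 ≤ b ^ p := by positivity
  rcases le_total β α with h | h
  · -- α ≥ β
    have h1 : |α * a - β * b| ≤ α * (a-b) + b * (α - β) := by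
      rw [abs_of_nonneg] <;> nlinarith [mul_nonneg hα hd, mul_nonneg hb (sub_nonneg.2 h)]
    have h2 : |α * a - β * b| ^ p ≤ 2^p * ((α * (a-b))^p + (b * (α - β))^p) :=
      (Real.rpow_le_rpow (abs_nonneg _) h1 (by linarith)).trans
        (add_rpow_le_two (by linarith) (mul_nonneg hα hd) (mul_nonneg hb (by linarith)))
    rw [Real.mul_rpow hα hd, Real.mul_rpow hb (by linarith)] at h2
    rw [abs_of_nonneg (sub_nonneg.2 h)]
    have h3 : β ^ p ≤ α ^ p := Real.rpow_le_rpow hβ h (by linarith)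
    have h4 : α^p * (a-b)^p ≤ (a - b) ^ (p-1) * (α ^ p * a - β ^ p * b) := by
      rw [← rpow_pm1_mul hp hd]
      have : 0 ≤ (a-b)^(p-1) := by positivity
      have : α^p * (a - b) ≤ α ^ p * a - β ^ p * b := by nlinarith
      calc _ = (a-b)^(p-1) * (α^p * (a-b)) := by ring
        _ ≤ _ := by gcongr
    have h5 : 0 ≤ (α - β)^p := Real.rpow_nonneg (by linarith) _
    have h6 : 0 ≤ α^p * (a-b)^p := by positivity
    set X := (a - b) ^ (p-1) * (α ^ p * a - β ^ p * b)
    have hX : 0 ≤ X := h6.trans h4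
    have hB : 0 ≤ a^p * (α-β)^p := by positivity
    have hB' : 0 ≤ b^p * (α-β)^p := by positivity
    calc _ ≤ _ := h2
      _ ≤ 2^p * (2 * X + (1 + C1) * ((a^p + b^p) * (α-β)^p)) := by
        apply mul_le_mul_of_nonneg_left _ h2p.le
        nlinarith [mul_nonneg hC1n hB, mul_nonneg hC1n hB']
      _ = _ := by ring
  · have h1 : |α * a - β * b| ≤ β * (a-b) + a * (β - α) := by
      rw [abs_le]; constructor <;> nlinarith [mul_nonneg hβ hd, mul_nonneg ha (sub_nonneg.2 h)]
    have h2 : |α * a - β * b| ^ p ≤ 2^p * ((β * (a-b))^p + (a * (β - α))^p) :=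
      (Real.rpow_le_rpow (abs_nonneg _) h1 (by linarith)).trans
        (add_rpow_le_two (by linarith) (mul_nonneg hβ hd) (mul_nonneg ha (by linarith)))
    rw [abs_sub_comm α β, abs_of_nonneg (sub_nonneg.2 h)]
    set X := β * (a-b) with hX
    set Y := a * (β - α) with hY
    have hXn : 0 ≤ X := mul_nonneg hβ hd
    have hYn : 0 ≤ Y := mul_nonneg ha (by linarith)
    have hYp : Y ^ p = a^p * (β-α)^p := Real.mul_rpow ha (by linarith)
    have hXp : X^p = (a-b)^(p-1) * (β^p * (a-b)) := by
      rw [hX, Real.mul_rpow hβ hd, ← rpow_pm1_mul hp hd]; ring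
    have hXp1 : X^(p-1) = β^(p-1) * (a-b)^(p-1) := Real.mul_rpow hβ hd
    have h3 : X^p - p * X^(p-1) * Y ≤ (a - b) ^ (p-1) * (α ^ p * a - β ^ p * b) := by
      have h4 := rpow_sub_le hp hα h
      have : 0 ≤ (a-b)^(p-1) := by positivity
      rw [hXp, hXp1, hY]
      have h5 : (a-b)^(p-1) * (β^p * (a-b)) - p * (β^(p-1) * (a-b)^(p-1)) * (a * (β-α)) =
        (a-b)^(p-1) * (β^p * (a-b) - a * (p * β^(p-1) * (β - α))) := by ring
      rw [h5]
      apply mul_le_mul_of_nonneg_left _ this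
      nlinarith
    have h4 : X^p ≤ 2 * (X^p - p * X^(p-1) * Y) + C1 * Y^p := by
      by_cases hc : 2 * p * Y ≤ X
      · have e : X^p = X^(p-1) * X := (rpow_pm1_mul hp hXn).symm
        have : X^(p-1) * (2 * p * Y) ≤ X^(p-1) * X := by gcongr
        have : 0 ≤ C1 * Y^p := by positivity
        nlinarith
      · push Not at hc
        have e1 : X^(p-1) ≤ (2*p*Y)^(p-1) := Real.rpow_le_rpow hXn hc.le (by linarith)
        rw [Real.mul_rpow (by linarith) hYn] at e1
        have e2 : X^(p-1) * Y ≤ (2*p)^(p-1) * Y^p := by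
          rw [← rpow_pm1_mul hp hYn]; exact (mul_le_mul_of_nonneg_right e1 hYn).trans_eq (mul_assoc _ _ _)
        have e3 : 0 ≤ X^p := by positivity
        have e4 : 2 * p * (X^(p-1) * Y) ≤ 2 * p * ((2*p)^(p-1) * Y^p) := by gcongr
        rw [hC1]; nlinarith
    have hYq : 0 ≤ Y^p := by positivity
    have h6 : 0 ≤ b^p * (β-α)^p := mul_nonneg hbp (Real.rpow_nonneg (by linarith) _)
    set Z := (a - b) ^ (p-1) * (α ^ p * a - β ^ p * b)
    have h7 : X^p + Y^p ≤ 2 * Z + (1 + C1) * ((a^p+b^p) * (β-α)^p) := by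
      have : (a^p+b^p) * (β-α)^p = Y^p + b^p * (β-α)^p := by rw [hYp]; ring
      rw [this]
      nlinarith [mul_nonneg hC1n h6]
    calc _ ≤ _ := h2
      _ ≤ 2^p * (2 * Z + (1 + C1) * ((a^p+b^p) * (β-α)^p)) := by gcongr
      _ = _ := by ring

/-- case `0 ≤ a`, `b ≤ 0`. -/
lemma alg_mixed {p : ℝ} (hp : 1 < p) {a b α : ℝ} (ha : 0 ≤ a) (hb : b ≤ 0) (hα : 0 ≤ α) :
    (α * a) ^ p + α ^ p * a * (-b) ^ (p-1) ≤ 2 * (Lf p a b * (α ^ p * a)) := by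
  rw [Lf_of_le hp (hb.trans ha), Real.mul_rpow hα ha]
  have h1 : a^(p-1) ≤ (a-b)^(p-1) := Real.rpow_le_rpow ha (by linarith) (by linarith)
  have h2 : (-b)^(p-1) ≤ (a-b)^(p-1) := Real.rpow_le_rpow (by linarith) (by linarith) (by linarith)
  have h3 : 0 ≤ α^p * a := by positivity
  rw [← rpow_pm1_mul hp ha]
  nlinarith [mul_le_mul_of_nonneg_left h1 h3, mul_le_mul_of_nonneg_left h2 h3]

noncomputable def algC (p : ℝ) : ℝ := 2 ^ p * (1 + 2 * p * (2 * p) ^ (p-1))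

lemma algC_pos {p : ℝ} (hp : 1 < p) : 0 < algC p := by unfold algC; positivity

/-- half of the pointwise Caccioppoli inequality -/
lemma alg_half {p : ℝ} (hp : 1 < p) {a b α β : ℝ} (hab : b ≤ a) (hα : 0 ≤ α) (hβ : 0 ≤ β) :
    |α * max a 0 - β * max b 0| ^ p + α ^ p * max a 0 * (max (-b) 0) ^ (p-1)
      + β ^ p * max b 0 * (max (-a) 0) ^ (p-1)
      ≤ 2 ^ p * 2 * (Lf p a b * (α ^ p * max a 0 - β ^ p * max b 0))
      + algC p * ((max a 0 ^ p + max b 0 ^ p) * |α - β| ^ p) := by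
  have hp0 : p ≠ 0 := by linarith
  have hp1 : p - 1 ≠ 0 := by linarith
  have hC := algC_pos hp
  have h2 : (1:ℝ) ≤ 2 ^ p := Real.one_le_rpow (by norm_num) (by linarith)
  have hbad : 0 ≤ algC p * ((max a 0 ^ p + max b 0 ^ p) * |α - β| ^ p) := by positivity
  rcases le_total b 0 with hb | hb
  · rcases le_total a 0 with ha | ha
    · rw [max_eq_right ha, max_eq_right hb] at *
      simp [Real.zero_rpow hp0]
    · rw [max_eq_left ha, max_eq_right hb, max_eq_left (by linarith : 0 ≤ -b),
        max_eq_right (by linarith : -a ≤ 0)] at *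
      have := alg_mixed hp ha hb hα
      simp only [mul_zero, sub_zero, zero_mul, add_zero]
      rw [abs_of_nonneg (mul_nonneg hα ha)]
      have h3 : 0 ≤ Lf p a b * (α^p * a) := by
        rw [Lf_of_le hp hab]
        have : 0 ≤ (a-b)^(p-1) := Real.rpow_nonneg (by linarith) _
        positivity
      rw [Real.zero_rpow hp0, add_zero] at hbad ⊢
      nlinarith
  · have ha : 0 ≤ a := hb.trans hab
    rw [max_eq_left ha, max_eq_left hb, max_eq_right (by linarith : -b ≤ 0),
        max_eq_right (by linarith : -a ≤ 0), Real.zero_rpow hp1, Lf_of_le hp hab]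
    have := alg_pos hp hb hab hα hβ
    simpa [algC] using this

/-- the pointwise Caccioppoli inequality -/
lemma alg_full {p : ℝ} (hp : 1 < p) {a b α β : ℝ} (hα : 0 ≤ α) (hβ : 0 ≤ β) :
    |α * max a 0 - β * max b 0| ^ p + α ^ p * max a 0 * (max (-b) 0) ^ (p-1)
      ≤ 2 ^ p * 2 * (Lf p a b * (α ^ p * max a 0 - β ^ p * max b 0))
      + algC p * ((max a 0 ^ p + max b 0 ^ p) * |α - β| ^ p) := by
  rcases le_total b a with h | h
  · have := alg_half hp h hα hβ
    have : 0 ≤ β ^ p * max b 0 * (max (-a) 0) ^ (p-1) := by positivity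
    linarith
  · have := alg_half hp h hβ hα
    have h1 : 0 ≤ β ^ p * max b 0 * (max (-a) 0) ^ (p-1) := by positivity
    rw [abs_sub_comm, abs_sub_comm β α, Lf_swap] at this
    have e : -Lf p a b * (β ^ p * max b 0 - α ^ p * max a 0) = Lf p a b * (α ^ p * max a 0 - β ^ p * max b 0) := by ring
    rw [e] at this
    linarith

/-- exterior part -/
lemma alg_ext {p : ℝ} (hp : 1 < p) {a b t : ℝ} (ht : 0 ≤ t) (ha : 0 < a ∨ t = 0) :
    0 ≤ Lf p a b * t + t * max b 0 ^ (p-1) := by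
  rcases ha with ha | rfl
  swap
  · simp
  rcases le_total b a with h | h
  · rw [Lf_of_le hp h]
    have : 0 ≤ (a-b)^(p-1) := Real.rpow_nonneg (by linarith) _
    positivity
  · rw [Lf_swap, Lf_of_le hp h]
    have : (b-a)^(p-1) ≤ max b 0 ^(p-1) :=
      Real.rpow_le_rpow (by linarith) (le_max_of_le_left (by linarith)) (by linarith)
    nlinarith

/-- volume of the unit ball -/
noncomputable def vb (n : ℕ) : ℝ := (volume (ball (0 : Euc n) 1)).toReal

lemma vb_pos (n : ℕ) : 0 < vb n :=
  ENNReal.toReal_pos (measure_ball_pos _ _ one_pos).ne' measure_ball_lt_top.ne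

lemma nontriv {n : ℕ} (hn : 1 ≤ n) : Nontrivial (Euc n) := by
  apply Module.nontrivial_of_finrank_pos (R := ℝ)
  simp; omega

lemma vol_ball {n : ℕ} (hn : 1 ≤ n) (x : Euc n) {r : ℝ} (hr : 0 ≤ r) :
    volume (ball x r) = ENNReal.ofReal (r ^ (n:ℝ) * vb n) := by
  have := nontriv hn
  rw [Measure.addHaar_ball volume x hr, ENNReal.ofReal_mul (by positivity), vb,
    ENNReal.ofReal_toReal measure_ball_lt_top.ne]
  simp

lemma scale_lint {n : ℕ} {r : ℝ} (hr : 0 < r) (h : Euc n → ℝ≥0∞) (hm : Measurable h) :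
    ∫⁻ x, h x = ENNReal.ofReal (r ^ (n:ℝ)) * ∫⁻ x, h (r • x) := by
  have h1 := lintegral_map (μ := (volume : Measure (Euc n))) hm (measurable_const_smul r)
  rw [Measure.map_addHaar_smul volume hr.ne', lintegral_smul_measure] at h1
  rw [← h1, smul_eq_mul, ← mul_assoc, ← ENNReal.ofReal_mul (by positivity)]
  have : r ^ (n:ℝ) * |(r ^ Module.finrank ℝ (Euc n))⁻¹| = 1 := by
    rw [abs_of_nonneg (by positivity)]
    simp
    field_simp
  rw [this]; simp

lemma near_bound {n : ℕ} (hn : 1 ≤ n) {a : ℝ} (ha : -(n:ℝ) < a) :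
    ∃ C : ℝ, 0 < C ∧ ∀ (x : Euc n) (r : ℝ), 0 < r →
      ∫⁻ y in ball x r, ENNReal.ofReal (‖x - y‖ ^ a) ≤ ENNReal.ofReal (C * r ^ (n + a)) := by
  have hIntOn : IntegrableOn (fun x : Euc n => ‖x‖ ^ a) (ball 0 1) volume := by
    refine integrableOn_ball_of_norm_le_rpow (C := 1) (α := -a) ?_ ?_ ?_ ?_
    · simpa using hn
    · simp; linarith
    · filter_upwards with x
      rw [Real.norm_of_nonneg (by positivity)]; simp
    · exact (measurable_norm.pow_const a).aestronglyMeasurable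
  have hfin : ∫⁻ y in ball (0 : Euc n) 1, ENNReal.ofReal (‖y‖ ^ a) < ⊤ := by
    have := hIntOn.2
    rw [hasFiniteIntegral_iff_ofReal (by filter_upwards with x; positivity)] at this
    exact this
  set I := ∫⁻ y in ball (0 : Euc n) 1, ENNReal.ofReal (‖y‖ ^ a) with hI
  refine ⟨I.toReal + 1, by positivity, fun x r hr => ?_⟩
  have hm : Measurable (fun y : Euc n => (ball (0:Euc n) r).indicator (fun y => ENNReal.ofReal (‖y‖ ^ a)) y) :=
    ((measurable_norm.pow_const a).ennreal_ofReal).indicator measurableSet_ball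
  have e1 : ∫⁻ y in ball x r, ENNReal.ofReal (‖x - y‖ ^ a)
      = ∫⁻ y, (ball (0:Euc n) r).indicator (fun y => ENNReal.ofReal (‖y‖ ^ a)) (x - y) := by
    rw [← lintegral_indicator measurableSet_ball]
    congr 1; ext y
    simp only [Set.indicator, mem_ball, dist_eq_norm, norm_sub_rev y x, sub_zero]
  rw [e1, lintegral_sub_left_eq_self (fun y => (ball (0:Euc n) r).indicator (fun y => ENNReal.ofReal (‖y‖ ^ a)) y) x,
    scale_lint hr _ hm]
  have e2 : ∀ y : Euc n, (ball (0:Euc n) r).indicator (fun y => ENNReal.ofReal (‖y‖ ^ a)) (r • y)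
      = ENNReal.ofReal (r ^ a) * (ball (0:Euc n) 1).indicator (fun y => ENNReal.ofReal (‖y‖ ^ a)) y := by
    intro y
    have : ‖r • y‖ = r * ‖y‖ := by rw [norm_smul, Real.norm_of_nonneg hr.le]
    have hh : (r * ‖y‖ < r) ↔ ‖y‖ < 1 := by
      constructor <;> intro h <;> nlinarith
    simp only [Set.indicator, mem_ball, dist_zero_right, this, hh]
    split_ifs
    · rw [Real.mul_rpow hr.le (norm_nonneg _), ENNReal.ofReal_mul (by positivity)]
    · simp
  simp_rw [e2]
  rw [lintegral_const_mul' _ _ ENNReal.ofReal_ne_top, lintegral_indicator measurableSet_ball, ← hI,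
    ← mul_assoc, ← ENNReal.ofReal_mul (by positivity), ← Real.rpow_add hr, mul_comm _ (r ^ _),
    ENNReal.ofReal_mul (by positivity)]
  gcongr
  rw [← ENNReal.ofReal_toReal hfin.ne]
  apply ENNReal.ofReal_le_ofReal
  simp

lemma far_bound {n : ℕ} {a : ℝ} (ha : (n:ℝ) < a) :
    ∃ C : ℝ, 0 < C ∧ ∀ (x : Euc n) (r : ℝ), 0 < r →
      ∫⁻ y in (ball x r)ᶜ, ENNReal.ofReal (‖y - x‖ ^ (-a)) ≤ ENNReal.ofReal (C * r ^ (n - a)) := by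
  have ha0 : 0 < a := lt_of_le_of_lt (Nat.cast_nonneg n) ha
  have hIntOn : IntegrableOn (fun x : Euc n => ‖x‖ ^ (-a)) (ball 0 1)ᶜ volume := by
    have h1 : Integrable (fun x : Euc n => 2 ^ a * (1 + ‖x‖) ^ (-a)) volume :=
      (integrable_one_add_norm (by simpa using ha)).const_mul _
    refine h1.integrableOn.mono' (measurable_norm.pow_const _).aestronglyMeasurable ?_
    refine (ae_restrict_iff' measurableSet_ball.compl).2 (Eventually.of_forall fun x hx => ?_)
    have hx1 : 1 ≤ ‖x‖ := by simpa using hx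
    rw [Real.norm_of_nonneg (by positivity)]
    have : ‖x‖ ^ (-a) = 2 ^ a * (2 * ‖x‖) ^ (-a) := by
      rw [Real.mul_rpow (by norm_num) (by positivity), ← mul_assoc, ← Real.rpow_add (by norm_num)]
      simp
    rw [this]
    gcongr 2 ^ a * ?_
    exact Real.rpow_le_rpow_of_nonpos (by positivity) (by linarith) (by linarith)
  have hfin : ∫⁻ y in (ball (0 : Euc n) 1)ᶜ, ENNReal.ofReal (‖y‖ ^ (-a)) < ⊤ := by
    have := hIntOn.2
    rw [hasFiniteIntegral_iff_ofReal (by filter_upwards with x; positivity)] at this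
    exact this
  set I := ∫⁻ y in (ball (0 : Euc n) 1)ᶜ, ENNReal.ofReal (‖y‖ ^ (-a)) with hI
  refine ⟨I.toReal + 1, by positivity, fun x r hr => ?_⟩
  have hm : Measurable (fun y : Euc n => (ball (0:Euc n) r)ᶜ.indicator (fun y => ENNReal.ofReal (‖y‖ ^ (-a))) y) :=
    ((measurable_norm.pow_const _).ennreal_ofReal).indicator measurableSet_ball.compl
  have e1 : ∫⁻ y in (ball x r)ᶜ, ENNReal.ofReal (‖y - x‖ ^ (-a))
      = ∫⁻ y, (ball (0:Euc n) r)ᶜ.indicator (fun y => ENNReal.ofReal (‖y‖ ^ (-a))) (x - y) := by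
    rw [← lintegral_indicator measurableSet_ball.compl]
    congr 1; ext y
    simp only [Set.indicator, Set.mem_compl_iff, mem_ball, dist_eq_norm, norm_sub_rev y x, sub_zero]
  rw [e1, lintegral_sub_left_eq_self (fun y => (ball (0:Euc n) r)ᶜ.indicator (fun y => ENNReal.ofReal (‖y‖ ^ (-a))) y) x,
    scale_lint hr _ hm]
  have e2 : ∀ y : Euc n, (ball (0:Euc n) r)ᶜ.indicator (fun y => ENNReal.ofReal (‖y‖ ^ (-a))) (r • y)
      = ENNReal.ofReal (r ^ (-a)) * (ball (0:Euc n) 1)ᶜ.indicator (fun y => ENNReal.ofReal (‖y‖ ^ (-a))) y := by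
    intro y
    have : ‖r • y‖ = r * ‖y‖ := by rw [norm_smul, Real.norm_of_nonneg hr.le]
    have hh : (r * ‖y‖ < r) ↔ ‖y‖ < 1 := by
      constructor <;> intro h <;> nlinarith
    simp only [Set.indicator, Set.mem_compl_iff, mem_ball, dist_zero_right, this, hh]
    split_ifs
    · simp
    · rw [Real.mul_rpow hr.le (norm_nonneg _), ENNReal.ofReal_mul (by positivity)]
  simp_rw [e2]
  rw [lintegral_const_mul' _ _ ENNReal.ofReal_ne_top, lintegral_indicator measurableSet_ball.compl, ← hI,
    ← mul_assoc, ← ENNReal.ofReal_mul (by positivity), ← Real.rpow_add hr, mul_comm _ (r ^ _),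
    ENNReal.ofReal_mul (by positivity), sub_eq_add_neg]
  gcongr
  rw [← ENNReal.ofReal_toReal hfin.ne]
  apply ENNReal.ofReal_le_ofReal
  simp

lemma faber_krahn {n : ℕ} (hn : 1 ≤ n) {s p : ℝ} (hs0 : 0 < s) (hp : 1 < p)
    {x0 : Euc n} {r t : ℝ} (ht : 0 < t) (htr : t ≤ r) {v : Euc n → ℝ} (hv : Measurable v)
    (hv0 : ∀ x, 0 ≤ v x)
    (hvol : volume {x | 0 < v x} ≤ ENNReal.ofReal (t ^ (n:ℝ) * vb n / 2)) :
    ∫⁻ x in ball x0 r, ENNReal.ofReal (v x ^ p) ≤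
      ENNReal.ofReal (2 * 2 ^ ((n:ℝ) + s * p) / vb n * t ^ (s * p)) *
      ∫⁻ x in ball x0 r, ∫⁻ y in ball x0 r,
        ENNReal.ofReal (|v x - v y| ^ p * ‖x - y‖ ^ (-((n:ℝ) + s * p))) := by
  have hr : 0 < r := ht.trans_le htr
  set κ := (n:ℝ) + s * p with hκ
  have hκ0 : 0 < κ := by positivity
  have hvb := vb_pos n
  rw [← lintegral_const_mul' _ _ ENNReal.ofReal_ne_top]
  refine setLIntegral_mono' measurableSet_ball fun x hx => ?_
  rcases (hv0 x).eq_or_lt with h0 | hpos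
  · rw [← h0, Real.zero_rpow (by linarith)]; simp
  set y' := x - (t / r) • (x - x0) with hy'
  have hxn : ‖x - x0‖ < r := by simpa [dist_eq_norm] using hx
  have htr1 : t / r ≤ 1 := (div_le_one hr).2 htr
  have hd1 : ‖y' - x‖ ≤ t := by
    have : y' - x = -((t/r) • (x - x0)) := by rw [hy']; abel
    rw [this, norm_neg, norm_smul, Real.norm_of_nonneg (by positivity)]
    calc t / r * ‖x - x0‖ ≤ t / r * r := by gcongr
      _ = t := by field_simp
  have hd2 : ‖y' - x0‖ ≤ r - t := by
    have : y' - x0 = (1 - t/r) • (x - x0) := by rw [hy', sub_smul, one_smul]; abel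
    rw [this, norm_smul, Real.norm_of_nonneg (by linarith)]
    calc (1 - t / r) * ‖x - x0‖ ≤ (1 - t / r) * r := by
          apply mul_le_mul_of_nonneg_left hxn.le; linarith
      _ = r - t := by field_simp
  set S := ball y' t \ {x | 0 < v x} with hS
  have hSm : MeasurableSet S := measurableSet_ball.diff (measurableSet_lt measurable_const hv)
  have hSsub : S ⊆ ball x0 r := by
    intro z hz
    have h1 : ‖z - y'‖ < t := by simpa [dist_eq_norm] using hz.1
    rw [mem_ball, dist_eq_norm]
    calc ‖z - x0‖ = ‖(z - y') + (y' - x0)‖ := by congr 1; abel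
      _ ≤ ‖z - y'‖ + ‖y' - x0‖ := norm_add_le _ _
      _ < r := by linarith
  have hSvol : ENNReal.ofReal (t ^ (n:ℝ) * vb n / 2) ≤ volume S := by
    have h1 : volume (ball y' t) - volume {x | 0 < v x} ≤ volume S := le_measure_sdiff
    refine le_trans ?_ h1
    rw [vol_ball hn y' ht.le]
    calc ENNReal.ofReal (t ^ (n:ℝ) * vb n / 2)
        = ENNReal.ofReal (t ^ (n:ℝ) * vb n) - ENNReal.ofReal (t ^ (n:ℝ) * vb n / 2) := by
          rw [← ENNReal.ofReal_sub _ (by positivity)]; congr 1; ring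
      _ ≤ _ := tsub_le_tsub_left hvol _
  have hlow : ENNReal.ofReal (v x ^ p * (2 * t) ^ (-κ)) * volume S ≤
      ∫⁻ y in ball x0 r, ENNReal.ofReal (|v x - v y| ^ p * ‖x - y‖ ^ (-κ)) := by
    rw [← setLIntegral_const]
    refine le_trans ?_ (lintegral_mono_set hSsub)
    refine setLIntegral_mono' hSm fun y hy => ENNReal.ofReal_le_ofReal ?_
    have hvy : v y = 0 := le_antisymm (not_lt.1 hy.2) (hv0 y)
    rw [hvy, sub_zero, abs_of_pos hpos]
    apply mul_le_mul_of_nonneg_left _ (by positivity)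
    have hne : x ≠ y := by rintro rfl; exact hy.2 hpos
    apply Real.rpow_le_rpow_of_nonpos (norm_pos_iff.2 (sub_ne_zero.2 hne)) _ (by linarith)
    have h1 : ‖y - y'‖ < t := by simpa [dist_eq_norm] using hy.1
    calc ‖x - y‖ = ‖(y - y') + (y' - x)‖ := by rw [norm_sub_rev]; congr 1; abel
      _ ≤ ‖y - y'‖ + ‖y' - x‖ := norm_add_le _ _
      _ ≤ 2 * t := by linarith
  calc ENNReal.ofReal (v x ^ p)
      = ENNReal.ofReal (2 * 2 ^ κ / vb n * t ^ (s * p)) *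
        (ENNReal.ofReal (v x ^ p * (2 * t) ^ (-κ)) * ENNReal.ofReal (t ^ (n:ℝ) * vb n / 2)) := by
        rw [← ENNReal.ofReal_mul (by positivity), ← ENNReal.ofReal_mul (by positivity)]
        congr 1
        rw [Real.mul_rpow (by norm_num) ht.le, Real.rpow_neg (by norm_num), Real.rpow_neg ht.le]
        have : t ^ κ = t ^ (n:ℝ) * t ^ (s * p) := by rw [hκ, Real.rpow_add ht]
        rw [this]
        field_simp
    _ ≤ _ := by gcongr; exact (mul_le_mul_right hSvol _).trans hlow

/-- Subsolution property at level `0` in the ball `ball x0 r`. -/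
def Sub0 (n : ℕ) (p : ℝ) (K : Euc n → Euc n → ℝ) (f : Euc n → ℝ) (x0 : Euc n) (r : ℝ) : Prop :=
  ∀ (η : Euc n → ℝ) (ρ : ℝ) (l : NNReal), 0 < ρ → ρ < r → LipschitzWith l η → (∀ x, 0 ≤ η x) →
    (∀ x, η x ≤ 1) → (∀ x, x ∉ ball x0 ρ → η x = 0) →
    Integrable (fun z : Euc n × Euc n => Lf p (f z.1) (f z.2) *
      (η z.1 ^ p * max (f z.1) 0 - η z.2 ^ p * max (f z.2) 0) * K z.1 z.2) ∧
    ∫ z : Euc n × Euc n, Lf p (f z.1) (f z.2) *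
      (η z.1 ^ p * max (f z.1) 0 - η z.2 ^ p * max (f z.2) 0) * K z.1 z.2 ≤ 0

lemma lint_le_of_test {α : Type*} [MeasurableSpace α] {μ : Measure α} {F G B : α → ℝ}
    (hF : Integrable F μ) (hF0 : ∫ z, F z ∂μ ≤ 0) (hG : ∀ z, 0 ≤ G z) (hB : ∀ z, 0 ≤ B z) (hBm : Measurable B)
    {C : ℝ} (hC : 0 ≤ C)
    (h : ∀ z, G z ≤ C * F z + B z) : ∫⁻ z, ENNReal.ofReal (G z) ∂μ ≤ ∫⁻ z, ENNReal.ofReal (B z) ∂μ := by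
  by_cases hfin : ∫⁻ z, ENNReal.ofReal (B z) ∂μ = ⊤
  · rw [hfin]; exact le_top
  have hBi : Integrable B μ := ⟨hBm.aestronglyMeasurable, by
    rw [hasFiniteIntegral_iff_ofReal (Eventually.of_forall hB)]; exact lt_top_iff_ne_top.2 hfin⟩
  have hi : Integrable (fun z => C * F z + B z) μ := (hF.const_mul C).add hBi
  calc ∫⁻ z, ENNReal.ofReal (G z) ∂μ ≤ ∫⁻ z, ENNReal.ofReal (C * F z + B z) ∂μ :=
        lintegral_mono fun z => ENNReal.ofReal_le_ofReal (h z)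
    _ = ENNReal.ofReal (∫ z, (C * F z + B z) ∂μ) :=
        (ofReal_integral_eq_lintegral_ofReal hi (Eventually.of_forall fun z => (hG z).trans (h z))).symm
    _ ≤ ENNReal.ofReal (∫ z, B z ∂μ) := by
        apply ENNReal.ofReal_le_ofReal
        rw [integral_add (hF.const_mul C) hBi, integral_const_mul]
        nlinarith
    _ = _ := ofReal_integral_eq_lintegral_ofReal hBi (Eventually.of_forall hB)

lemma kernel_bounds {n : ℕ} {s p Λ : ℝ} (hs0 : 0 < s) (hp : 1 < p) (hΛ : 1 ≤ Λ)
    {K : Euc n → Euc n → ℝ} (hK : IsKernel n s p Λ K) :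
    ∀ᵐ z : Euc n × Euc n, ‖z.1 - z.2‖ ^ (-((n:ℝ) + s * p)) ≤ Λ * K z.1 z.2 ∧
      K z.1 z.2 ≤ Λ * ‖z.1 - z.2‖ ^ (-((n:ℝ) + s * p)) := by
  filter_upwards [hK.2.2.2] with z hz
  have hsp : 0 < s * p := by positivity
  have hκ0 : 0 < (n:ℝ) + s * p := by positivity
  have hpos : 0 < ‖z.1 - z.2‖ := by
    rcases (norm_nonneg (z.1 - z.2)).eq_or_lt with h | h
    · exfalso
      rw [← h, Real.zero_rpow hκ0.ne', mul_zero] at hz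
      have : 0 < Λ⁻¹ := by positivity
      linarith [hz.1]
    · exact h
  have hq : 0 < ‖z.1 - z.2‖ ^ ((n:ℝ) + s * p) := by positivity
  rw [Real.rpow_neg hpos.le]
  constructor
  · rw [inv_le_iff_one_le_mul₀ hq]
    have := hz.1
    rw [inv_le_iff_one_le_mul₀ (by linarith)] at this
    linarith
  · rw [← div_eq_mul_inv, le_div_iff₀ hq]; exact hz.2

lemma Lf_measurable {α : Type*} [MeasurableSpace α] {p : ℝ} {a b : α → ℝ} (ha : Measurable a) (hb : Measurable b) :
    Measurable (fun z => Lf p (a z) (b z)) := by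
  unfold Lf
  exact (((ha.sub hb).abs).pow_const _).mul (ha.sub hb)

lemma ofReal_ind {α : Type*} (S : Set α) (f : α → ℝ) (z : α) :
    ENNReal.ofReal (S.indicator f z) = S.indicator (fun z => ENNReal.ofReal (f z)) z := by
  by_cases h : z ∈ S <;> simp [h]


lemma cacc_pt {n : ℕ} {p : ℝ} (hp : 1 < p) (K : Euc n → Euc n → ℝ) (hK0 : ∀ x y, 0 ≤ K x y)
    (f : Euc n → ℝ) (B Bρ : Set (Euc n)) (hss : Bρ ⊆ B) {η : Euc n → ℝ}
    (hη0 : ∀ x, 0 ≤ η x) (hη1 : ∀ x, η x ≤ 1)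
    (hηs : ∀ x, x ∉ Bρ → η x = 0) (z : Euc n × Euc n) :
    (B ×ˢ B).indicator (fun z => (|η z.1 * max (f z.1) 0 - η z.2 * max (f z.2) 0| ^ p
        + η z.1 ^ p * max (f z.1) 0 * max (-f z.2) 0 ^ (p-1)) * K z.1 z.2) z ≤
    2 ^ p * 2 * (Lf p (f z.1) (f z.2) *
      (η z.1 ^ p * max (f z.1) 0 - η z.2 ^ p * max (f z.2) 0) * K z.1 z.2) +
    ((B ×ˢ B).indicator (fun z => algC p * (((max (f z.1) 0) ^ p + (max (f z.2) 0) ^ p) * |η z.1 - η z.2| ^ p * K z.1 z.2)) z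
      + (Bρ ×ˢ Bᶜ).indicator (fun z => 2 ^ p * 2 * (max (f z.1) 0 * (max (f z.2) 0) ^ (p-1) * K z.1 z.2)) z
      + (Bᶜ ×ˢ Bρ).indicator (fun z => 2 ^ p * 2 * (max (f z.2) 0 * (max (f z.1) 0) ^ (p-1) * K z.1 z.2)) z) := by
  obtain ⟨x, y⟩ := z
  have hp0 : p ≠ 0 := by linarith
  have h4 : (0:ℝ) ≤ 2 ^ p * 2 := by positivity
  have key : ∀ x y, 0 ≤ (Lf p (f x) (f y) * (η x ^ p * max (f x) 0) + max (f x) 0 * max (f y) 0 ^ (p-1)) := by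
    intro x y
    have ht : 0 ≤ η x ^ p * max (f x) 0 := by have := hη0 x; positivity
    have h1 := alg_ext hp (a := f x) (b := f y) ht (by
      by_cases h : 0 < f x
      · exact Or.inl h
      · right; rw [max_eq_right (not_lt.1 h), mul_zero])
    have h2 : η x ^ p * max (f x) 0 * max (f y) 0 ^ (p-1) ≤ max (f x) 0 * max (f y) 0 ^ (p-1) := by
      have : η x ^ p ≤ 1 := Real.rpow_le_one (hη0 x) (hη1 x) (by linarith)
      have : η x ^ p * max (f x) 0 ≤ 1 * max (f x) 0 := by gcongr
      rw [one_mul] at this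
      gcongr
    linarith
  classical
  simp only [Set.indicator_apply, Set.mem_prod, Set.mem_compl_iff]
  by_cases hx : x ∈ B <;> by_cases hy : y ∈ B
  · simp only [hx, hy, not_true, and_true, and_false, false_and, if_true, if_false]
    have := mul_le_mul_of_nonneg_right (alg_full hp (a := f x) (b := f y) (hη0 x) (hη0 y)) (hK0 x y)
    linarith
  · have hηy : η y = 0 := hηs y (fun h => hy (hss h))
    have hyρ : y ∉ Bρ := fun h => hy (hss h)
    by_cases hxρ : x ∈ Bρ
    · simp only [hx, hy, hxρ, hyρ, not_true, not_false_eq_true, and_true, and_false, if_true, if_false, hηy, Real.zero_rpow hp0, zero_mul, sub_zero, zero_add, add_zero]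
      nlinarith [mul_nonneg h4 (mul_nonneg (key x y) (hK0 x y))]
    · simp only [hx, hy, hxρ, hyρ, not_true, not_false_eq_true, and_true, and_false, if_false, hηy, hηs x hxρ, Real.zero_rpow hp0, zero_mul, sub_zero, mul_zero, add_zero, le_refl]
  · have hηx : η x = 0 := hηs x (fun h => hx (hss h))
    have hxρ : x ∉ Bρ := fun h => hx (hss h)
    by_cases hyρ : y ∈ Bρ
    · simp only [hx, hy, hxρ, hyρ, not_true, not_false_eq_true, and_true, and_false, false_and, if_true, if_false, hηx, Real.zero_rpow hp0, zero_mul, zero_sub, zero_add, add_zero]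
      have := key y x
      rw [Lf_swap] at this
      nlinarith [mul_nonneg h4 (mul_nonneg this (hK0 x y))]
    · simp only [hx, hy, hxρ, hyρ, not_true, not_false_eq_true, and_true, and_false, false_and, if_false, hηx, hηs y hyρ, Real.zero_rpow hp0, zero_mul, sub_zero, mul_zero, add_zero, le_refl]
  · have hηx : η x = 0 := hηs x (fun h => hx (hss h))
    have hηy : η y = 0 := hηs y (fun h => hy (hss h))
    have hxρ : x ∉ Bρ := fun h => hx (hss h)
    have hyρ : y ∉ Bρ := fun h => hy (hss h)
    simp only [hx, hy, hxρ, hyρ, and_false, false_and, if_false, hηx, hηy, Real.zero_rpow hp0, zero_mul, sub_zero, mul_zero, add_zero, le_refl]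

set_option maxHeartbeats 1000000 in
/-- integrated form of the Caccioppoli inequality, first version -/
lemma cacc1 {n : ℕ} {s p Λ : ℝ} (hs0 : 0 < s) (hp : 1 < p) (hΛ : 1 ≤ Λ)
    {K : Euc n → Euc n → ℝ} (hK : IsKernel n s p Λ K) {f : Euc n → ℝ} (hf : Measurable f)
    {x0 : Euc n} {r ρ r' : ℝ} (hsub : Sub0 n p K f x0 r) (hρ : 0 < ρ) (hρr : ρ < r') (hr' : r' ≤ r)
    {η : Euc n → ℝ} {l : NNReal} (hl : LipschitzWith l η) (hη0 : ∀ x, 0 ≤ η x) (hη1 : ∀ x, η x ≤ 1)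
    (hηs : ∀ x, x ∉ ball x0 ρ → η x = 0) :
    ∫⁻ z in ball x0 r' ×ˢ ball x0 r', ENNReal.ofReal
      ((|η z.1 * max (f z.1) 0 - η z.2 * max (f z.2) 0| ^ p
        + η z.1 ^ p * max (f z.1) 0 * max (-f z.2) 0 ^ (p-1)) * ‖z.1 - z.2‖ ^ (-((n:ℝ) + s * p)))
    ≤ ENNReal.ofReal (Λ * Λ * algC p) * (∫⁻ z in ball x0 r' ×ˢ ball x0 r', ENNReal.ofReal
      (((max (f z.1) 0) ^ p + (max (f z.2) 0) ^ p) * |η z.1 - η z.2| ^ p * ‖z.1 - z.2‖ ^ (-((n:ℝ) + s * p))))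
    + ENNReal.ofReal (Λ * Λ * (2 ^ p * 2)) * (∫⁻ z in ball x0 ρ ×ˢ (ball x0 r')ᶜ, ENNReal.ofReal
      (max (f z.1) 0 * (max (f z.2) 0) ^ (p-1) * ‖z.1 - z.2‖ ^ (-((n:ℝ) + s * p))))
    + ENNReal.ofReal (Λ * Λ * (2 ^ p * 2)) * ∫⁻ z in (ball x0 r')ᶜ ×ˢ ball x0 ρ, ENNReal.ofReal
      (max (f z.2) 0 * (max (f z.1) 0) ^ (p-1) * ‖z.1 - z.2‖ ^ (-((n:ℝ) + s * p))) := by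
  obtain ⟨hF, hF0⟩ := hsub η ρ l hρ (hρr.trans_le hr') hl hη0 hη1 hηs
  set κ := (n:ℝ) + s * p with hκ
  set B := ball x0 r' with hB
  set Bρ := ball x0 ρ with hBρ
  have hss : Bρ ⊆ B := ball_subset_ball hρr.le
  have hηm : Measurable η := hl.continuous.measurable
  have hBm : MeasurableSet B := measurableSet_ball
  have hBρm : MeasurableSet Bρ := measurableSet_ball
  have hKm : Measurable (fun z : Euc n × Euc n => K z.1 z.2) := hK.1
  have hK0 : ∀ x y, 0 ≤ K x y := hK.2.2.1
  set g0 : Euc n × Euc n → ℝ := fun z => |η z.1 * max (f z.1) 0 - η z.2 * max (f z.2) 0| ^ p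
        + η z.1 ^ p * max (f z.1) 0 * max (-f z.2) 0 ^ (p-1) with hg0
  set b1 : Euc n × Euc n → ℝ := fun z => ((max (f z.1) 0) ^ p + (max (f z.2) 0) ^ p) * |η z.1 - η z.2| ^ p with hb1
  set b2 : Euc n × Euc n → ℝ := fun z => max (f z.1) 0 * (max (f z.2) 0) ^ (p-1) with hb2
  set b3 : Euc n × Euc n → ℝ := fun z => max (f z.2) 0 * (max (f z.1) 0) ^ (p-1) with hb3
  have hf1 : Measurable (fun z : Euc n × Euc n => f z.1) := hf.comp measurable_fst
  have hf2 : Measurable (fun z : Euc n × Euc n => f z.2) := hf.comp measurable_snd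
  have hη1' : Measurable (fun z : Euc n × Euc n => η z.1) := hηm.comp measurable_fst
  have hη2' : Measurable (fun z : Euc n × Euc n => η z.2) := hηm.comp measurable_snd
  have hb1m : Measurable b1 := by simp only [hb1]; fun_prop
  have hb2m : Measurable b2 := by simp only [hb2]; fun_prop
  have hb3m : Measurable b3 := by simp only [hb3]; fun_prop
  have hg00 : ∀ z, 0 ≤ g0 z := fun z => by
    have := hη0 z.1
    simp only [hg0]; positivity
  have hb10 : ∀ z, 0 ≤ b1 z := fun z => by simp only [hb1]; positivity
  have hb20 : ∀ z, 0 ≤ b2 z := fun z => by simp only [hb2]; positivity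
  have hb30 : ∀ z, 0 ≤ b3 z := fun z => by simp only [hb3]; positivity
  have hC := algC_pos hp
  have hwm : Measurable (fun z : Euc n × Euc n => ‖z.1 - z.2‖ ^ (-κ)) := by fun_prop
  have hkb := kernel_bounds hs0 hp hΛ hK
  -- step 1
  have step1 := lint_le_of_test (μ := (volume : Measure (Euc n × Euc n))) (C := 2 ^ p * 2)
    (G := (B ×ˢ B).indicator (fun z => g0 z * K z.1 z.2))
    (B := fun z => (B ×ˢ B).indicator (fun z => algC p * (b1 z * K z.1 z.2)) z
      + (Bρ ×ˢ Bᶜ).indicator (fun z => 2 ^ p * 2 * (b2 z * K z.1 z.2)) z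
      + (Bᶜ ×ˢ Bρ).indicator (fun z => 2 ^ p * 2 * (b3 z * K z.1 z.2)) z) hF hF0
    (fun z => Set.indicator_nonneg (fun z _ => mul_nonneg (hg00 z) (hK0 _ _)) z)
    (fun z => by
      refine add_nonneg (add_nonneg (Set.indicator_nonneg (fun z _ => ?_) z) (Set.indicator_nonneg (fun z _ => ?_) z))
        (Set.indicator_nonneg (fun z _ => ?_) z)
      · exact mul_nonneg hC.le (mul_nonneg (hb10 z) (hK0 _ _))
      · exact mul_nonneg (by positivity) (mul_nonneg (hb20 z) (hK0 _ _))
      · exact mul_nonneg (by positivity) (mul_nonneg (hb30 z) (hK0 _ _)))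
    (by
      refine Measurable.add (Measurable.add ?_ ?_) ?_
      · exact ((hb1m.mul hKm).const_mul _).indicator (hBm.prod hBm)
      · exact ((hb2m.mul hKm).const_mul _).indicator (hBρm.prod hBm.compl)
      · exact ((hb3m.mul hKm).const_mul _).indicator (hBm.compl.prod hBρm))
    (by positivity)
    (by
      exact fun z => cacc_pt hp K hK0 f B Bρ hss hη0 hη1 hηs z)
  -- rewrite the left side
  have hL : ∫⁻ z in B ×ˢ B, ENNReal.ofReal (g0 z * ‖z.1 - z.2‖ ^ (-κ)) ≤
      ENNReal.ofReal Λ * ∫⁻ z, ENNReal.ofReal ((B ×ˢ B).indicator (fun z => g0 z * K z.1 z.2) z) := by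
    simp_rw [ofReal_ind]
    rw [lintegral_indicator (hBm.prod hBm), ← lintegral_const_mul' _ _ ENNReal.ofReal_ne_top]
    refine lintegral_mono_ae (ae_restrict_of_ae ?_)
    filter_upwards [hkb] with z hz
    rw [← ENNReal.ofReal_mul (by linarith)]
    apply ENNReal.ofReal_le_ofReal
    calc g0 z * ‖z.1 - z.2‖ ^ (-κ) ≤ g0 z * (Λ * K z.1 z.2) := mul_le_mul_of_nonneg_left hz.1 (hg00 z)
      _ = _ := by ring
  have hU : ∀ (S : Set (Euc n × Euc n)) (_ : MeasurableSet S) (b : Euc n × Euc n → ℝ) (_ : ∀ z, 0 ≤ b z) (c : ℝ) (_ : 0 ≤ c),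
      ENNReal.ofReal Λ * ∫⁻ z, ENNReal.ofReal (S.indicator (fun z => c * (b z * K z.1 z.2)) z) ≤
      ENNReal.ofReal (Λ * Λ * c) * ∫⁻ z in S, ENNReal.ofReal (b z * ‖z.1 - z.2‖ ^ (-κ)) := by
    intro S hS b hb c hc
    simp_rw [ofReal_ind]
    rw [lintegral_indicator hS, ← lintegral_const_mul' _ _ ENNReal.ofReal_ne_top,
      ← lintegral_const_mul' _ _ ENNReal.ofReal_ne_top]
    refine lintegral_mono_ae (ae_restrict_of_ae ?_)
    filter_upwards [hkb] with z hz
    rw [← ENNReal.ofReal_mul (by linarith), ← ENNReal.ofReal_mul (by positivity)]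
    apply ENNReal.ofReal_le_ofReal
    calc Λ * (c * (b z * K z.1 z.2)) ≤ Λ * (c * (b z * (Λ * ‖z.1 - z.2‖ ^ (-κ)))) := by
          have := hb z
          gcongr
          exact hz.2
      _ = _ := by ring
  refine hL.trans ((mul_le_mul_right step1 _).trans ?_)
  have hsplit : ∫⁻ z, ENNReal.ofReal ((B ×ˢ B).indicator (fun z => algC p * (b1 z * K z.1 z.2)) z
      + (Bρ ×ˢ Bᶜ).indicator (fun z => 2 ^ p * 2 * (b2 z * K z.1 z.2)) z
      + (Bᶜ ×ˢ Bρ).indicator (fun z => 2 ^ p * 2 * (b3 z * K z.1 z.2)) z)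
      = (∫⁻ z, ENNReal.ofReal ((B ×ˢ B).indicator (fun z => algC p * (b1 z * K z.1 z.2)) z))
      + (∫⁻ z, ENNReal.ofReal ((Bρ ×ˢ Bᶜ).indicator (fun z => 2 ^ p * 2 * (b2 z * K z.1 z.2)) z))
      + ∫⁻ z, ENNReal.ofReal ((Bᶜ ×ˢ Bρ).indicator (fun z => 2 ^ p * 2 * (b3 z * K z.1 z.2)) z) := by
    rw [← lintegral_add_left, ← lintegral_add_left]
    · congr 1; ext z
      rw [ENNReal.ofReal_add, ENNReal.ofReal_add]
      · exact Set.indicator_nonneg (fun z _ => mul_nonneg hC.le (mul_nonneg (hb10 z) (hK0 _ _))) z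
      · exact Set.indicator_nonneg (fun z _ => mul_nonneg (by positivity) (mul_nonneg (hb20 z) (hK0 _ _))) z
      · exact add_nonneg (Set.indicator_nonneg (fun z _ => mul_nonneg hC.le (mul_nonneg (hb10 z) (hK0 _ _))) z)
          (Set.indicator_nonneg (fun z _ => mul_nonneg (by positivity) (mul_nonneg (hb20 z) (hK0 _ _))) z)
      · exact Set.indicator_nonneg (fun z _ => mul_nonneg (by positivity) (mul_nonneg (hb30 z) (hK0 _ _))) z
    · exact ((((hb1m.mul hKm).const_mul _).indicator (hBm.prod hBm)).ennreal_ofReal).add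
        ((((hb2m.mul hKm).const_mul _).indicator (hBρm.prod hBm.compl)).ennreal_ofReal)
    · exact (((hb1m.mul hKm).const_mul _).indicator (hBm.prod hBm)).ennreal_ofReal
  rw [hsplit, mul_add, mul_add]
  exact add_le_add (add_le_add (hU _ (hBm.prod hBm) b1 hb10 _ hC.le)
    (hU _ (hBρm.prod hBm.compl) b2 hb20 _ (by positivity)))
    (hU _ (hBm.compl.prod hBρm) b3 hb30 _ (by positivity))

lemma lint_prod_swap {n : ℕ} (A B : Set (Euc n)) (F : Euc n × Euc n → ℝ≥0∞) :
    ∫⁻ z in A ×ˢ B, F z = ∫⁻ z in B ×ˢ A, F z.swap := by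
  rw [Measure.volume_eq_prod, ← Measure.prod_restrict, ← Measure.prod_restrict, ← Measure.prod_swap]
  exact lintegral_map_equiv F MeasurableEquiv.prodComm

/-- first term -/
lemma cacc_t1 {n : ℕ} (hn : 1 ≤ n) {s p : ℝ} (hs1 : s < 1) (hp : 1 < p) :
    ∃ C : ℝ, 0 < C ∧ ∀ (f : Euc n → ℝ) (_ : Measurable f) (x0 : Euc n) (r' : ℝ) (_ : 0 < r')
    (η : Euc n → ℝ) (l : NNReal) (_ : LipschitzWith l η),
    ∫⁻ z in ball x0 r' ×ˢ ball x0 r', ENNReal.ofReal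
      (((max (f z.1) 0) ^ p + (max (f z.2) 0) ^ p) * |η z.1 - η z.2| ^ p * ‖z.1 - z.2‖ ^ (-((n:ℝ) + s * p)))
    ≤ ENNReal.ofReal (C * ((l:ℝ) ^ p * r' ^ (p - s * p))) * ∫⁻ x in ball x0 r', ENNReal.ofReal (max (f x) 0 ^ p) := by
  obtain ⟨C, hC, hnear⟩ := near_bound hn (a := p - ((n:ℝ) + s * p)) (by nlinarith)
  refine ⟨2 * C * 2 ^ (p - s * p), by positivity, ?_⟩
  intro f hf x0 r' hr' η l hl
  set κ := (n:ℝ) + s * p with hκ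
  set B := ball x0 r' with hB
  have hBm : MeasurableSet B := measurableSet_ball
  have hηm : Measurable η := hl.continuous.measurable
  have hf1 : Measurable (fun z : Euc n × Euc n => f z.1) := hf.comp measurable_fst
  have hf2 : Measurable (fun z : Euc n × Euc n => f z.2) := hf.comp measurable_snd
  have hη1' : Measurable (fun z : Euc n × Euc n => η z.1) := hηm.comp measurable_fst
  have hη2' : Measurable (fun z : Euc n × Euc n => η z.2) := hηm.comp measurable_snd
  have hsp : ∀ z : Euc n × Euc n, ENNReal.ofReal
      (((max (f z.1) 0) ^ p + (max (f z.2) 0) ^ p) * |η z.1 - η z.2| ^ p * ‖z.1 - z.2‖ ^ (-κ))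
      = ENNReal.ofReal ((max (f z.1) 0) ^ p * |η z.1 - η z.2| ^ p * ‖z.1 - z.2‖ ^ (-κ)) +
        ENNReal.ofReal ((max (f z.2) 0) ^ p * |η z.1 - η z.2| ^ p * ‖z.1 - z.2‖ ^ (-κ)) := by
    intro z
    rw [← ENNReal.ofReal_add (by positivity) (by positivity)]
    congr 1; ring
  simp_rw [hsp]
  rw [lintegral_add_left (by fun_prop)]
  rw [lint_prod_swap B B (fun z => ENNReal.ofReal ((max (f z.2) 0) ^ p * |η z.1 - η z.2| ^ p * ‖z.1 - z.2‖ ^ (-κ)))]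
  have hsw : ∀ z : Euc n × Euc n, ENNReal.ofReal ((max (f z.swap.2) 0) ^ p * |η z.swap.1 - η z.swap.2| ^ p * ‖z.swap.1 - z.swap.2‖ ^ (-κ))
    = ENNReal.ofReal ((max (f z.1) 0) ^ p * |η z.1 - η z.2| ^ p * ‖z.1 - z.2‖ ^ (-κ)) := by
    intro z
    simp only [Prod.fst_swap, Prod.snd_swap]
    rw [abs_sub_comm, norm_sub_rev]
  simp_rw [hsw]
  have main : ∫⁻ z in B ×ˢ B, ENNReal.ofReal ((max (f z.1) 0) ^ p * |η z.1 - η z.2| ^ p * ‖z.1 - z.2‖ ^ (-κ))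
      ≤ ENNReal.ofReal (C * 2 ^ (p - s * p) * ((l:ℝ) ^ p * r' ^ (p - s * p))) * ∫⁻ x in B, ENNReal.ofReal (max (f x) 0 ^ p) := by
    rw [Measure.volume_eq_prod, ← Measure.prod_restrict, lintegral_prod _ (by fun_prop),
      ← lintegral_const_mul' _ _ ENNReal.ofReal_ne_top]
    refine setLIntegral_mono' hBm fun x hx => ?_
    calc ∫⁻ y in B, ENNReal.ofReal ((max (f x) 0) ^ p * |η x - η y| ^ p * ‖x - y‖ ^ (-κ))
        ≤ ∫⁻ y in B, ENNReal.ofReal ((max (f x) 0) ^ p * (l:ℝ) ^ p) * ENNReal.ofReal (‖x - y‖ ^ (p - κ)) := by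
          refine lintegral_mono fun y => ?_
          rw [← ENNReal.ofReal_mul (by positivity)]
          apply ENNReal.ofReal_le_ofReal
          rw [mul_assoc, mul_assoc]
          apply mul_le_mul_of_nonneg_left _ (by positivity)
          by_cases hxy : x = y
          · subst hxy
            rw [sub_self, abs_zero, Real.zero_rpow (by linarith), zero_mul]
            positivity
          · have hpos : 0 < ‖x - y‖ := norm_pos_iff.2 (sub_ne_zero.2 hxy)
            have h1 : |η x - η y| ≤ l * ‖x - y‖ := by
              have := hl.dist_le_mul x y
              rwa [Real.dist_eq, dist_eq_norm] at this
            calc |η x - η y| ^ p * ‖x - y‖ ^ (-κ) ≤ (l * ‖x - y‖) ^ p * ‖x - y‖ ^ (-κ) := by gcongr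
              _ = _ := by
                rw [Real.mul_rpow (by positivity) (by positivity), mul_assoc, ← Real.rpow_add hpos]; rfl
      _ = ENNReal.ofReal ((max (f x) 0) ^ p * (l:ℝ) ^ p) * ∫⁻ y in B, ENNReal.ofReal (‖x - y‖ ^ (p - κ)) := by
          rw [lintegral_const_mul' _ _ ENNReal.ofReal_ne_top]
      _ ≤ ENNReal.ofReal ((max (f x) 0) ^ p * (l:ℝ) ^ p) * ENNReal.ofReal (C * (2 * r') ^ (n + (p - κ))) := by
          gcongr
          refine (lintegral_mono_set ?_).trans (hnear x (2 * r') (by positivity))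
          intro y hy
          rw [mem_ball] at *
          have : dist x x0 < r' := hx
          have : dist y x0 < r' := hy
          have := dist_triangle_right y x x0
          linarith
      _ = _ := by
          rw [← ENNReal.ofReal_mul (by positivity), ← ENNReal.ofReal_mul (by positivity)]
          congr 1
          have : (n:ℝ) + (p - κ) = p - s * p := by rw [hκ]; ring
          rw [this, Real.mul_rpow (by norm_num) hr'.le]
          ring
  calc _ ≤ _ := add_le_add main main
    _ = _ := by
      rw [← add_mul, ← ENNReal.ofReal_add (by positivity) (by positivity)]
      congr 2; ring

lemma far_dist {n : ℕ} {κ : ℝ} (hκ : 0 ≤ κ) {x0 x y : Euc n} {ρ r' : ℝ} (hρ : 0 < ρ) (hρr : ρ < r')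
    (hx : x ∈ ball x0 ρ) (hy : y ∉ ball x0 r') :
    ‖x - y‖ ^ (-κ) ≤ (r' / (r' - ρ)) ^ κ * ‖y - x0‖ ^ (-κ) := by
  have hx' : ‖x - x0‖ < ρ := by simpa [dist_eq_norm] using hx
  have hy' : r' ≤ ‖y - x0‖ := by simpa [dist_eq_norm] using hy
  have h1 : ‖y - x0‖ ≤ ‖x - y‖ + ‖x - x0‖ := by
    calc ‖y - x0‖ = ‖(x - x0) - (x - y)‖ := by congr 1; abel
      _ ≤ ‖x - x0‖ + ‖x - y‖ := norm_sub_le _ _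
      _ = _ := add_comm _ _
  have hd : 0 < r' - ρ := by linarith
  have hr : 0 < r' := by linarith
  have h2 : (r' - ρ) / r' * ‖y - x0‖ ≤ ‖x - y‖ := by
    rw [div_mul_eq_mul_div, div_le_iff₀ hr]
    nlinarith
  have h3 : 0 < ‖y - x0‖ := by linarith
  calc ‖x - y‖ ^ (-κ) ≤ ((r' - ρ) / r' * ‖y - x0‖) ^ (-κ) :=
        Real.rpow_le_rpow_of_nonpos (by positivity) h2 (by linarith)
    _ = _ := by
      rw [Real.mul_rpow (by positivity) (by positivity), Real.rpow_neg (by positivity),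
        ← Real.inv_rpow (by positivity), inv_div]

/-- positive tail -/
noncomputable def tl (n : ℕ) (s p : ℝ) (f : Euc n → ℝ) (x0 : Euc n) (r : ℝ) : ℝ≥0∞ :=
  ∫⁻ y in (ball x0 r)ᶜ, ENNReal.ofReal (max (f y) 0 ^ (p-1) * ‖y - x0‖ ^ (-((n:ℝ) + s * p)))

lemma cacc_t2 {n : ℕ} {s p : ℝ} (hs0 : 0 < s) (hp : 1 < p)
    {f : Euc n → ℝ} (hf : Measurable f) (x0 : Euc n) {ρ r' : ℝ} (hρ : 0 < ρ) (hρr : ρ < r') :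
    ∫⁻ z in ball x0 ρ ×ˢ (ball x0 r')ᶜ, ENNReal.ofReal
      (max (f z.1) 0 * (max (f z.2) 0) ^ (p-1) * ‖z.1 - z.2‖ ^ (-((n:ℝ) + s * p)))
    ≤ ENNReal.ofReal ((r' / (r' - ρ)) ^ ((n:ℝ) + s * p)) *
      ((∫⁻ x in ball x0 ρ, ENNReal.ofReal (max (f x) 0)) * tl n s p f x0 r') := by
  have hκ : 0 ≤ (n:ℝ) + s * p := by positivity
  have hd : 0 < r' - ρ := by linarith
  have hr : 0 < r' := by linarith
  have e : ((∫⁻ x in ball x0 ρ, ENNReal.ofReal (max (f x) 0)) * tl n s p f x0 r') =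
    ∫⁻ z in ball x0 ρ ×ˢ (ball x0 r')ᶜ, ENNReal.ofReal (max (f z.1) 0) *
      ENNReal.ofReal (max (f z.2) 0 ^ (p-1) * ‖z.2 - x0‖ ^ (-((n:ℝ) + s * p))) := by
    rw [Measure.volume_eq_prod, ← Measure.prod_restrict, tl]
    rw [← lintegral_prod_mul (f := fun x => ENNReal.ofReal (max (f x) 0))
      (g := fun y => ENNReal.ofReal (max (f y) 0 ^ (p-1) * ‖y - x0‖ ^ (-((n:ℝ) + s * p)))) (by fun_prop) (by fun_prop)]
  rw [e, ← lintegral_const_mul' _ _ ENNReal.ofReal_ne_top]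
  refine setLIntegral_mono' (measurableSet_ball.prod measurableSet_ball.compl) fun z hz => ?_
  rw [← ENNReal.ofReal_mul (by positivity), ← ENNReal.ofReal_mul (by positivity)]
  apply ENNReal.ofReal_le_ofReal
  have := far_dist hκ hρ hρr hz.1 hz.2
  calc _ ≤ max (f z.1) 0 * (max (f z.2) 0) ^ (p-1) * ((r' / (r' - ρ)) ^ ((n:ℝ) + s * p) * ‖z.2 - x0‖ ^ (-((n:ℝ) + s * p))) :=
        mul_le_mul_of_nonneg_left this (by positivity)
    _ = _ := by ring

/-- Caccioppoli inequality -/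
lemma cacc2 {n : ℕ} (hn : 1 ≤ n) {s p Λ : ℝ} (hs0 : 0 < s) (hs1 : s < 1) (hp : 1 < p) (hΛ : 1 ≤ Λ) :
    ∃ C : ℝ, 0 < C ∧ ∀ (K : Euc n → Euc n → ℝ) (_ : IsKernel n s p Λ K) (f : Euc n → ℝ) (_ : Measurable f)
    (x0 : Euc n) (r ρ r' : ℝ) (_ : Sub0 n p K f x0 r) (_ : 0 < ρ) (_ : ρ < r') (_ : r' ≤ r)
    (η : Euc n → ℝ) (l : NNReal) (_ : LipschitzWith l η) (_ : ∀ x, 0 ≤ η x) (_ : ∀ x, η x ≤ 1)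
    (_ : ∀ x, x ∉ ball x0 ρ → η x = 0),
    ∫⁻ z in ball x0 r' ×ˢ ball x0 r', ENNReal.ofReal
      ((|η z.1 * max (f z.1) 0 - η z.2 * max (f z.2) 0| ^ p
        + η z.1 ^ p * max (f z.1) 0 * max (-f z.2) 0 ^ (p-1)) * ‖z.1 - z.2‖ ^ (-((n:ℝ) + s * p)))
    ≤ ENNReal.ofReal (C * ((l:ℝ) ^ p * r' ^ (p - s * p))) * (∫⁻ x in ball x0 r', ENNReal.ofReal (max (f x) 0 ^ p))
      + ENNReal.ofReal (C * (r' / (r' - ρ)) ^ ((n:ℝ) + s * p)) *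
      ((∫⁻ x in ball x0 ρ, ENNReal.ofReal (max (f x) 0)) * tl n s p f x0 r') := by
  obtain ⟨C, hC, ht1⟩ := cacc_t1 hn hs1 hp
  have hA := algC_pos hp
  refine ⟨Λ * Λ * algC p * C + 2 * (Λ * Λ * (2 ^ p * 2)), by positivity, ?_⟩
  intro K hK f hf x0 r ρ r' hsub hρ hρr hr' η l hl hη0 hη1 hηs
  have hd : 0 < r' - ρ := by linarith
  have hr0 : 0 < r' := by linarith
  refine (cacc1 hs0 hp hΛ hK hf hsub hρ hρr hr' hl hη0 hη1 hηs).trans ?_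
  rw [lint_prod_swap ((ball x0 r')ᶜ) (ball x0 ρ)]
  have hsw : ∀ z : Euc n × Euc n, ENNReal.ofReal
      (max (f z.swap.2) 0 * (max (f z.swap.1) 0) ^ (p-1) * ‖z.swap.1 - z.swap.2‖ ^ (-((n:ℝ) + s * p))) =
      ENNReal.ofReal (max (f z.1) 0 * (max (f z.2) 0) ^ (p-1) * ‖z.1 - z.2‖ ^ (-((n:ℝ) + s * p))) := by
    intro z
    simp only [Prod.fst_swap, Prod.snd_swap]
    rw [norm_sub_rev]
  simp_rw [hsw]
  have h1 := ht1 f hf x0 r' hr0 η l hl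
  have h2 := cacc_t2 (s := s) hs0 hp hf x0 hρ hρr
  rw [add_assoc]
  refine add_le_add ?_ ?_
  · refine (mul_le_mul_right h1 _).trans ?_
    rw [← mul_assoc, ← ENNReal.ofReal_mul (by positivity)]
    refine mul_le_mul_left (ENNReal.ofReal_le_ofReal ?_) _
    rw [← mul_assoc]
    have : 0 ≤ Λ * Λ * (2 ^ p * 2) := by positivity
    exact mul_le_mul_of_nonneg_right (by linarith) (by positivity)
  · rw [← add_mul, ← ENNReal.ofReal_add (by positivity) (by positivity)]
    refine (mul_le_mul_right h2 _).trans ?_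
    rw [← mul_assoc, ← ENNReal.ofReal_mul (by positivity)]
    refine mul_le_mul_left (ENNReal.ofReal_le_ofReal ?_) _
    have : 0 ≤ Λ * Λ * algC p * C := by positivity
    exact mul_le_mul_of_nonneg_right (by linarith) (by positivity)

lemma cutoff {n : ℕ} (x0 : Euc n) {a b : ℝ} (hab : a < b) :
    ∃ (η : Euc n → ℝ) (l : NNReal), (l:ℝ) = 1 / (b - a) ∧ LipschitzWith l η ∧ (∀ x, 0 ≤ η x) ∧ (∀ x, η x ≤ 1) ∧
      (∀ x ∈ ball x0 a, η x = 1) ∧ (∀ x, x ∉ ball x0 b → η x = 0) := by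
  have hd : 0 < b - a := by linarith
  refine ⟨fun x => max 0 (min 1 ((b - ‖x - x0‖) / (b - a))), ⟨1 / (b-a), by positivity⟩, rfl, ?_, ?_, ?_, ?_, ?_⟩
  · apply LipschitzWith.const_max
    apply LipschitzWith.const_min
    apply LipschitzWith.of_dist_le_mul
    intro x y
    show dist _ _ ≤ (1 / (b-a)) * dist x y
    rw [Real.dist_eq, ← sub_div, abs_div, abs_of_pos hd, dist_eq_norm, one_div, div_eq_inv_mul]
    gcongr
    have := abs_norm_sub_norm_le (y - x0) (x - x0)
    calc |b - ‖x - x0‖ - (b - ‖y - x0‖)| = |‖y - x0‖ - ‖x - x0‖| := by congr 1; ring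
      _ ≤ _ := this
      _ = ‖x - y‖ := by rw [← norm_neg]; congr 1; abel
  · intro x; exact le_max_left _ _
  · intro x; exact max_le zero_le_one (min_le_left _ _)
  · intro x hx
    have : ‖x - x0‖ < a := by simpa [dist_eq_norm] using hx
    have h1 : 1 ≤ (b - ‖x - x0‖) / (b - a) := by rw [le_div_iff₀ hd]; linarith
    simp only [min_eq_left h1]; simp
  · intro x hx
    have : b ≤ ‖x - x0‖ := by simpa [dist_eq_norm] using hx
    apply max_eq_left
    exact (min_le_right _ _).trans (div_nonpos_of_nonpos_of_nonneg (by linarith) hd.le)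

lemma trunc_le {p f k0 k1 e : ℝ} (hp : 1 < p) (he : 0 < e) (hk : e ≤ k1 - k0) :
    max (f - k1) 0 ≤ e⁻¹ ^ (p-1) * max (f - k0) 0 ^ p := by
  by_cases h : f ≤ k1
  · rw [max_eq_right (by linarith)]; positivity
  push Not at h
  rw [max_eq_left (by linarith), max_eq_left (by linarith), ← rpow_pm1_mul hp (by linarith), ← mul_assoc,
    ← Real.mul_rpow (by positivity) (by linarith)]
  have h1 : 1 ≤ (e⁻¹ * (f - k0)) ^ (p-1) := by
    apply Real.one_le_rpow _ (by linarith)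
    rw [inv_mul_eq_div, le_div_iff₀ he]; linarith
  nlinarith

lemma cheb {n : ℕ} {p k0 k1 e : ℝ} (hp : 1 < p) (he : 0 < e) (hk : e ≤ k1 - k0) {f : Euc n → ℝ} (B : Set (Euc n))
    (hf : Measurable f)  (S : Set (Euc n)) (hS : S ⊆ B ∩ {x | k1 < f x}) (hB : MeasurableSet B) :
    volume S ≤ ENNReal.ofReal (e⁻¹ ^ p) * ∫⁻ x in B, ENNReal.ofReal (max (f x - k0) 0 ^ p) := by
  have hm : MeasurableSet {x | k1 < f x} := measurableSet_lt measurable_const hf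
  calc volume S ≤ volume (B ∩ {x | k1 < f x}) := measure_mono hS
    _ = ∫⁻ x in B ∩ {x | k1 < f x}, 1 := by simp
    _ ≤ ∫⁻ x in B ∩ {x | k1 < f x}, ENNReal.ofReal (e⁻¹ ^ p) * ENNReal.ofReal (max (f x - k0) 0 ^ p) := by
        refine setLIntegral_mono' (hB.inter hm) fun x hx => ?_
        have : k1 < f x := hx.2
        rw [← ENNReal.ofReal_mul (by positivity), ← Real.mul_rpow (by positivity) (by positivity), ← ENNReal.ofReal_one]
        apply ENNReal.ofReal_le_ofReal
        apply Real.one_le_rpow _ (by linarith)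
        rw [max_eq_left (by linarith), inv_mul_eq_div, le_div_iff₀ he]; linarith
    _ ≤ ∫⁻ x in B, ENNReal.ofReal (e⁻¹ ^ p) * ENNReal.ofReal (max (f x - k0) 0 ^ p) :=
        lintegral_mono_set Set.inter_subset_left
    _ = _ := lintegral_const_mul' _ _ ENNReal.ofReal_ne_top

lemma tl_mono {n : ℕ} {s p : ℝ} (hp : 1 < p) {f g : Euc n → ℝ} {x0 : Euc n} {r r' : ℝ}
    (hr : r ≤ r') (hfg : ∀ x, f x ≤ g x) : tl n s p f x0 r' ≤ tl n s p g x0 r := by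
  unfold tl
  refine (lintegral_mono_set (Set.compl_subset_compl.2 (ball_subset_ball hr))).trans (lintegral_mono fun y => ?_)
  apply ENNReal.ofReal_le_ofReal
  apply mul_le_mul_of_nonneg_right _ (by positivity)
  exact Real.rpow_le_rpow (by positivity) (max_le_max (hfg y) le_rfl) (by linarith)

set_option maxHeartbeats 1000000 in
lemma dg_step {n : ℕ} (hn : 1 ≤ n) {s p Λ : ℝ} (hs0 : 0 < s) (hs1 : s < 1) (hp : 1 < p) (hΛ : 1 ≤ Λ) :
    ∃ C : ℝ, 0 < C ∧ ∀ (K : Euc n → Euc n → ℝ) (_ : IsKernel n s p Λ K) (f : Euc n → ℝ) (_ : Measurable f)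
    (x0 : Euc n) (r A d k0 k1 ρ0 ρ1 D t : ℝ) (_ : 0 < r) (_ : 0 ≤ A) (_ : 0 < d) (_ : 0 ≤ k1)
    (_ : d / D ≤ k1 - k0) (_ : r / D ≤ ρ0 - ρ1) (_ : r / 2 ≤ ρ1) (_ : ρ0 ≤ r) (_ : 1 ≤ D) (_ : 0 < t) (_ : t ≤ r / 2)
    (_ : Sub0 n p K (fun x => f x - k1) x0 r)
    (_ : tl n s p f x0 (r/2) ≤ ENNReal.ofReal (A * d ^ (p-1) * r ^ (-(s*p))))
    (_ : ENNReal.ofReal ((D/d) ^ p) * (∫⁻ x in ball x0 ρ0, ENNReal.ofReal (max (f x - k0) 0 ^ p)) ≤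
      ENNReal.ofReal (t ^ (n:ℝ) * vb n / 2)),
    ∫⁻ x in ball x0 ρ1, ENNReal.ofReal (max (f x - k1) 0 ^ p) ≤
      ENNReal.ofReal (C * (1 + A) * (2 * D) ^ ((n:ℝ) + s * p + p) * (t / r) ^ (s * p)) *
        ∫⁻ x in ball x0 ρ0, ENNReal.ofReal (max (f x - k0) 0 ^ p) := by
  obtain ⟨C, hC, hcacc⟩ := cacc2 hn hs0 hs1 hp hΛ
  have hvb := vb_pos n
  refine ⟨2 * 2 ^ ((n:ℝ) + s * p) / vb n * C, by positivity, ?_⟩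
  intro K hK f hf x0 r A d k0 k1 ρ0 ρ1 D t hr hA hd hk1 hk hρ hρ1 hρ0 hD ht htr hsub htl hY
  set κ := (n:ℝ) + s * p with hκ
  have hD0 : 0 < D := by linarith
  have hrD : 0 < r / D := by positivity
  have hdD : 0 < d / D := by positivity
  have hρ10 : 0 < ρ1 := by linarith
  have hsp : 0 < s * p := by positivity
  set ρ := (ρ0 + ρ1) / 2 with hρd
  have hρa : ρ1 < ρ := by rw [hρd]; linarith
  have hρb : ρ < ρ0 := by rw [hρd]; linarith
  obtain ⟨η, l, hl, hlip, hη0, hη1, hηa, hηb⟩ := cutoff x0 hρa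
  have hηm : Measurable η := hlip.continuous.measurable
  have hw : Measurable fun x => f x - k1 := hf.sub_const _
  have hc := hcacc K hK (fun x => f x - k1) hw x0 r ρ ρ0 hsub (by linarith) hρb hρ0 η l hlip hη0 hη1 hηb
  set Y0 := ∫⁻ x in ball x0 ρ0, ENNReal.ofReal (max (f x - k0) 0 ^ p) with hY0
  -- Faber-Krahn
  have hfk := faber_krahn hn (s := s) hs0 hp ht (htr.trans (by linarith : r / 2 ≤ ρ0)) (x0 := x0)
    (v := fun x => η x * max (f x - k1) 0) (by fun_prop)
    (fun x => mul_nonneg (hη0 x) (le_max_right _ _)) (by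
      refine (cheb (k0 := k0) (k1 := k1) (e := d / D) hp hdD hk (ball x0 ρ0) hf _ ?_ measurableSet_ball).trans ?_
      · intro x hx
        have hx' : 0 < η x * max (f x - k1) 0 := hx
        refine ⟨?_, ?_⟩
        · by_contra h
          rw [hηb x (fun h' => h (ball_subset_ball hρb.le h')), zero_mul] at hx'
          exact lt_irrefl _ hx'
        · by_contra h
          have h : f x ≤ k1 := not_lt.1 h
          rw [max_eq_right (by linarith), mul_zero] at hx'
          exact lt_irrefl _ hx'
      · rw [inv_div]; exact hY)
  -- the Sobolev energy
  have hE : ∫⁻ x in ball x0 ρ0, ∫⁻ y in ball x0 ρ0, ENNReal.ofReal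
      (|η x * max (f x - k1) 0 - η y * max (f y - k1) 0| ^ p * ‖x - y‖ ^ (-κ)) ≤
      ENNReal.ofReal (C * (1 + A) * (2 * D) ^ (κ + p) * r ^ (-(s * p))) * Y0 := by
    have e1 : ∫⁻ x in ball x0 ρ0, ∫⁻ y in ball x0 ρ0, ENNReal.ofReal
      (|η x * max (f x - k1) 0 - η y * max (f y - k1) 0| ^ p * ‖x - y‖ ^ (-κ)) =
      ∫⁻ z in ball x0 ρ0 ×ˢ ball x0 ρ0, ENNReal.ofReal
      (|η z.1 * max (f z.1 - k1) 0 - η z.2 * max (f z.2 - k1) 0| ^ p * ‖z.1 - z.2‖ ^ (-κ)) := by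
      have hf1 : Measurable (fun z : Euc n × Euc n => f z.1) := hf.comp measurable_fst
      have hf2 : Measurable (fun z : Euc n × Euc n => f z.2) := hf.comp measurable_snd
      have hη1' : Measurable (fun z : Euc n × Euc n => η z.1) := hηm.comp measurable_fst
      have hη2' : Measurable (fun z : Euc n × Euc n => η z.2) := hηm.comp measurable_snd
      rw [Measure.volume_eq_prod, ← Measure.prod_restrict, lintegral_prod _ (by fun_prop)]
    rw [e1]
    have e2 : ∫⁻ z in ball x0 ρ0 ×ˢ ball x0 ρ0, ENNReal.ofReal
      (|η z.1 * max (f z.1 - k1) 0 - η z.2 * max (f z.2 - k1) 0| ^ p * ‖z.1 - z.2‖ ^ (-κ)) ≤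
      ∫⁻ z in ball x0 ρ0 ×ˢ ball x0 ρ0, ENNReal.ofReal
      ((|η z.1 * max (f z.1 - k1) 0 - η z.2 * max (f z.2 - k1) 0| ^ p
        + η z.1 ^ p * max (f z.1 - k1) 0 * max (-(f z.2 - k1)) 0 ^ (p-1)) * ‖z.1 - z.2‖ ^ (-κ)) := by
      refine lintegral_mono fun z => ENNReal.ofReal_le_ofReal ?_
      apply mul_le_mul_of_nonneg_right _ (by positivity)
      have := hη0 z.1
      have : 0 ≤ η z.1 ^ p * max (f z.1 - k1) 0 * max (-(f z.2 - k1)) 0 ^ (p-1) := by positivity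
      linarith
    refine (e2.trans hc).trans ?_
    have hgap : r / (2 * D) ≤ ρ0 - ρ := by
      have : ρ0 - ρ = (ρ0 - ρ1) / 2 := by rw [hρd]; ring
      rw [this]
      have : r / (2 * D) = r / D / 2 := by field_simp
      linarith
    have hgap' : r / (2 * D) ≤ ρ - ρ1 := by
      have : ρ - ρ1 = (ρ0 - ρ1) / 2 := by rw [hρd]; ring
      rw [this]
      have : r / (2 * D) = r / D / 2 := by field_simp
      linarith
    have hr2D : 0 < r / (2 * D) := by positivity
    have hρ00 : 0 < ρ0 := by linarith
    -- first term
    have T1 : C * ((l:ℝ) ^ p * ρ0 ^ (p - s * p)) ≤ C * (2 * D) ^ (κ + p) * r ^ (-(s * p)) := by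
      have h1 : (l:ℝ) ≤ 2 * D / r := by
        rw [hl]
        calc 1 / (ρ - ρ1) ≤ 1 / (r / (2 * D)) := by gcongr
          _ = _ := by field_simp
      have h2 : ρ0 ^ (p - s * p) ≤ r ^ (p - s * p) := Real.rpow_le_rpow hρ00.le hρ0 (by nlinarith)
      have h3 : (2 * D) ^ p ≤ (2 * D) ^ (κ + p) :=
        Real.rpow_le_rpow_of_exponent_le (by linarith) (by rw [hκ]; have : (0:ℝ) ≤ n := by positivity
                                                           linarith)
      calc C * ((l:ℝ) ^ p * ρ0 ^ (p - s * p)) ≤ C * ((2 * D / r) ^ p * r ^ (p - s * p)) := by gcongr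
        _ = C * ((2 * D) ^ p * r ^ (-(s * p))) := by
            rw [Real.div_rpow (by positivity) hr.le, sub_eq_add_neg, Real.rpow_add hr]
            field_simp
        _ ≤ C * ((2 * D) ^ (κ + p) * r ^ (-(s * p))) := by gcongr
        _ = _ := by ring
    have T1' : ∫⁻ x in ball x0 ρ0, ENNReal.ofReal (max (f x - k1) 0 ^ p) ≤ Y0 := by
      refine lintegral_mono fun x => ENNReal.ofReal_le_ofReal ?_
      apply Real.rpow_le_rpow (by positivity) _ (by linarith)
      exact max_le_max (by linarith) le_rfl
    -- second term
    have T2' : ∫⁻ x in ball x0 ρ, ENNReal.ofReal (max (f x - k1) 0) ≤ ENNReal.ofReal ((D / d) ^ (p-1)) * Y0 := by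
      rw [hY0, ← lintegral_const_mul' _ _ ENNReal.ofReal_ne_top]
      refine (lintegral_mono_set (ball_subset_ball hρb.le)).trans (lintegral_mono fun x => ?_)
      rw [← ENNReal.ofReal_mul (by positivity)]
      apply ENNReal.ofReal_le_ofReal
      have := trunc_le (f := f x) hp hdD hk
      rwa [inv_div] at this
    have T2'' : tl n s p (fun x => f x - k1) x0 ρ0 ≤ ENNReal.ofReal (A * d ^ (p-1) * r ^ (-(s*p))) :=
      (tl_mono hp (by linarith) (fun x => by linarith)).trans htl
    have T2 : C * (ρ0 / (ρ0 - ρ)) ^ κ * ((D / d) ^ (p-1) * (A * d ^ (p-1) * r ^ (-(s*p)))) ≤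
        C * A * (2 * D) ^ (κ + p) * r ^ (-(s * p)) := by
      have hg0 : 0 < ρ0 - ρ := by linarith
      have h1 : ρ0 / (ρ0 - ρ) ≤ 2 * D := by
        rw [div_le_iff₀ hg0]
        calc ρ0 ≤ r := hρ0
          _ = 2 * D * (r / (2 * D)) := by field_simp
          _ ≤ _ := by gcongr
      have h2 : (D / d) ^ (p-1) * d ^ (p-1) = D ^ (p-1) := by
        rw [← Real.mul_rpow (by positivity) hd.le, div_mul_cancel₀ _ hd.ne']
      have h3 : D ^ (p-1) ≤ (2 * D) ^ p := by
        calc D ^ (p-1) ≤ (2 * D) ^ (p-1) := Real.rpow_le_rpow hD0.le (by linarith) (by linarith)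
          _ ≤ (2 * D) ^ p := Real.rpow_le_rpow_of_exponent_le (by linarith) (by linarith)
      calc C * (ρ0 / (ρ0 - ρ)) ^ κ * ((D / d) ^ (p-1) * (A * d ^ (p-1) * r ^ (-(s*p))))
          = C * (ρ0 / (ρ0 - ρ)) ^ κ * (A * ((D / d) ^ (p-1) * d ^ (p-1)) * r ^ (-(s*p))) := by ring
        _ = C * (ρ0 / (ρ0 - ρ)) ^ κ * (A * D ^ (p-1) * r ^ (-(s*p))) := by rw [h2]
        _ ≤ C * (2 * D) ^ κ * (A * (2 * D) ^ p * r ^ (-(s*p))) := by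
            have h4 : (ρ0 / (ρ0 - ρ)) ^ κ ≤ (2 * D) ^ κ :=
              Real.rpow_le_rpow (by positivity) h1 (by rw [hκ]; positivity)
            have h5 : C * (ρ0 / (ρ0 - ρ)) ^ κ ≤ C * (2 * D) ^ κ := mul_le_mul_of_nonneg_left h4 hC.le
            have h6 : A * D ^ (p-1) * r ^ (-(s*p)) ≤ A * (2 * D) ^ p * r ^ (-(s*p)) :=
              mul_le_mul_of_nonneg_right (mul_le_mul_of_nonneg_left h3 hA) (by positivity)
            exact mul_le_mul h5 h6 (by positivity) (by positivity)
        _ = _ := by rw [Real.rpow_add (x := 2 * D) (by positivity) κ p]; ring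
    have hg0 : 0 < ρ0 - ρ := by linarith
    calc _ ≤ ENNReal.ofReal (C * (2 * D) ^ (κ + p) * r ^ (-(s * p))) * Y0 +
          ENNReal.ofReal (C * (ρ0 / (ρ0 - ρ)) ^ κ) * ((ENNReal.ofReal ((D / d) ^ (p-1)) * Y0) *
            ENNReal.ofReal (A * d ^ (p-1) * r ^ (-(s*p)))) := by
          exact add_le_add (mul_le_mul' (ENNReal.ofReal_le_ofReal T1) T1')
            (mul_le_mul' le_rfl (mul_le_mul' T2' T2''))
      _ = ENNReal.ofReal (C * (2 * D) ^ (κ + p) * r ^ (-(s * p))) * Y0 +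
          ENNReal.ofReal (C * (ρ0 / (ρ0 - ρ)) ^ κ * ((D / d) ^ (p-1) * (A * d ^ (p-1) * r ^ (-(s*p))))) * Y0 := by
          rw [ENNReal.ofReal_mul (p := C * (ρ0 / (ρ0 - ρ)) ^ κ) (by positivity), ENNReal.ofReal_mul (p := (D / d) ^ (p-1)) (by positivity)]
          ring
      _ ≤ ENNReal.ofReal (C * (2 * D) ^ (κ + p) * r ^ (-(s * p))) * Y0 +
          ENNReal.ofReal (C * A * (2 * D) ^ (κ + p) * r ^ (-(s * p))) * Y0 :=
          add_le_add le_rfl (mul_le_mul' (ENNReal.ofReal_le_ofReal T2) le_rfl)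
      _ = _ := by
          rw [← add_mul, ← ENNReal.ofReal_add (by positivity) (by positivity)]
          congr 2; ring
  calc ∫⁻ x in ball x0 ρ1, ENNReal.ofReal (max (f x - k1) 0 ^ p)
      ≤ ∫⁻ x in ball x0 ρ1, ENNReal.ofReal ((η x * max (f x - k1) 0) ^ p) := by
        refine setLIntegral_mono' measurableSet_ball fun x hx => ?_
        rw [hηa x hx, one_mul]
    _ ≤ ∫⁻ x in ball x0 ρ0, ENNReal.ofReal ((η x * max (f x - k1) 0) ^ p) :=
        lintegral_mono_set (ball_subset_ball (by linarith))
    _ ≤ _ := hfk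
    _ ≤ ENNReal.ofReal (2 * 2 ^ κ / vb n * t ^ (s * p)) *
      (ENNReal.ofReal (C * (1 + A) * (2 * D) ^ (κ + p) * r ^ (-(s * p))) * Y0) := mul_le_mul' le_rfl hE
    _ = _ := by
      rw [← mul_assoc, ← ENNReal.ofReal_mul (by positivity)]
      congr 2
      rw [Real.div_rpow ht.le hr.le, Real.rpow_neg hr.le]
      ring

lemma dg_alg (Y X E V T L R : ℝ) (hY : Y ≠ 0) (hE : E ≠ 0) (hX : X ≠ 0) :
    Y * X / E * (V * T / (2 * Y) * (L * X⁻¹) * E * R) = R * (T * L) * V / 2 := by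
  field_simp

/-- De Giorgi lemma -/
lemma lemB {n : ℕ} (hn : 1 ≤ n) {s p Λ : ℝ} (hs0 : 0 < s) (hs1 : s < 1) (hp : 1 < p) (hΛ : 1 ≤ Λ) (A : ℝ) (hA : 0 ≤ A) :
    ∃ ν : ℝ, 0 < ν ∧ ∀ (K : Euc n → Euc n → ℝ) (_ : IsKernel n s p Λ K) (f : Euc n → ℝ) (_ : Measurable f)
    (x0 : Euc n) (r d : ℝ) (_ : 0 < r) (_ : 0 < d)
    (_ : ∀ k, 0 ≤ k → Sub0 n p K (fun x => f x - k) x0 r)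
    (_ : tl n s p f x0 (r/2) ≤ ENNReal.ofReal (A * d ^ (p-1) * r ^ (-(s*p))))
    (_ : ∫⁻ x in ball x0 r, ENNReal.ofReal (max (f x) 0 ^ p) ≤ ENNReal.ofReal (ν * d ^ p * r ^ (n:ℝ))),
    ∀ᵐ x, x ∈ ball x0 (r/2) → f x ≤ d := by
  obtain ⟨C, hC, hstep⟩ := dg_step hn hs0 hs1 hp hΛ
  have hvb := vb_pos n
  have hsp : 0 < s * p := by positivity
  set m := (n:ℝ) + s * p + p with hm
  have hm0 : 0 < m := by positivity
  set lam : ℝ := 2 ^ (-(m / (s * p))) with hlam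
  have hlam0 : 0 < lam := by positivity
  have hlam1 : lam ≤ 1 := Real.rpow_le_one_of_one_le_of_nonpos (by norm_num) (by
    have : 0 ≤ m / (s * p) := by positivity
    linarith)
  have hlamsp : lam ^ (s * p) * 2 ^ m = 1 := by
    rw [hlam, ← Real.rpow_mul (by norm_num), ← Real.rpow_add (by norm_num)]
    rw [show -(m / (s * p)) * (s * p) + m = 0 by field_simp; ring, Real.rpow_zero]
  set q : ℝ := lam ^ (n:ℝ) * (2 ^ p)⁻¹ with hq
  have hq0 : 0 < q := by positivity
  have hq1 : q < 1 := by
    have h1 : lam ^ (n:ℝ) ≤ 1 := Real.rpow_le_one hlam0.le hlam1 (by positivity)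
    have h2 : (1:ℝ) < 2 ^ p := Real.one_lt_rpow (by norm_num) (by linarith)
    have h3 : ((2:ℝ) ^ p)⁻¹ < 1 := inv_lt_one_of_one_lt₀ h2
    calc q ≤ 1 * (2 ^ p)⁻¹ := mul_le_mul_of_nonneg_right h1 (by positivity)
      _ < 1 := by linarith
  set τ : ℝ := min (1/2) ((q / (C * (1 + A) * 8 ^ m)) ^ (1 / (s * p))) with hτ
  have hτ0 : 0 < τ := by
    apply lt_min (by norm_num); positivity
  have hτ2 : τ ≤ 1 / 2 := min_le_left _ _
  have hτq : C * (1 + A) * 8 ^ m * τ ^ (s * p) ≤ q := by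
    have h1 : τ ^ (s * p) ≤ q / (C * (1 + A) * 8 ^ m) := by
      calc τ ^ (s * p) ≤ ((q / (C * (1 + A) * 8 ^ m)) ^ (1 / (s * p))) ^ (s * p) :=
            Real.rpow_le_rpow hτ0.le (min_le_right _ _) hsp.le
        _ = _ := by rw [← Real.rpow_mul (by positivity), one_div_mul_cancel hsp.ne', Real.rpow_one]
    rw [le_div_iff₀ (by positivity)] at h1
    linarith
  refine ⟨vb n * τ ^ (n:ℝ) / (2 * 4 ^ p), by positivity, ?_⟩
  intro K hK f hf x0 r d hr hd hsub htl hY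
  set N := vb n * τ ^ (n:ℝ) / (2 * 4 ^ p) with hN
  have hN0 : 0 < N := by positivity
  have claim : ∀ j : ℕ, ∫⁻ x in ball x0 (r/2 + r/2 * (1/2)^j), ENNReal.ofReal (max (f x - d * (1 - (1/2)^j)) 0 ^ p)
      ≤ ENNReal.ofReal (N * q ^ j * d ^ p * r ^ (n:ℝ)) := by
    intro j
    induction j with
    | zero => simpa using hY
    | succ j ih =>
      have hD : (1:ℝ) ≤ 4 * 2 ^ j := by have : (1:ℝ) ≤ 2 ^ j := one_le_pow₀ (by norm_num)
                                        linarith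
      have h2j : ((1:ℝ)/2)^j * 2 ^ j = 1 := by rw [← mul_pow]; norm_num
      have h2j0 : (0:ℝ) < 2 ^ j := by positivity
      have hhj0 : (0:ℝ) < (1/2) ^ j := by positivity
      have hhj1 : ((1:ℝ)/2) ^ j ≤ 1 := pow_le_one₀ (by norm_num) (by norm_num)
      have hl1 : lam ^ j ≤ 1 := pow_le_one₀ hlam0.le hlam1
      have e4 : (1:ℝ) / (4 * 2 ^ j) = (1/2) ^ j / 4 := by
        rw [div_eq_div_iff (by positivity) (by norm_num)]; nlinarith
      have hst := hstep K hK f hf x0 r A d (d * (1 - (1/2)^j)) (d * (1 - (1/2)^(j+1)))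
        (r/2 + r/2 * (1/2)^j) (r/2 + r/2 * (1/2)^(j+1)) (4 * 2 ^ j) (r * (τ * lam ^ j)) hr hA hd
        (by apply mul_nonneg hd.le; rw [pow_succ]; linarith)
        (by
          rw [div_eq_mul_one_div, e4, pow_succ]; nlinarith)
        (by rw [div_eq_mul_one_div, e4, pow_succ]; nlinarith)
        (by have : 0 ≤ r/2 * (1/2)^(j+1) := by positivity
            linarith)
        (by nlinarith)
        hD (by positivity)
        (by
          have : τ * lam ^ j ≤ 1/2 * 1 := mul_le_mul hτ2 hl1 (by positivity) (by norm_num)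
          nlinarith)
        (hsub _ (by apply mul_nonneg hd.le; rw [pow_succ]; linarith)) htl
        (by
          refine (mul_le_mul' le_rfl ih).trans ?_
          rw [← ENNReal.ofReal_mul (by positivity)]
          apply ENNReal.ofReal_le_ofReal
          apply le_of_eq
          rw [Real.div_rpow (by positivity) hd.le, Real.mul_rpow (by norm_num) h2j0.le,
            Real.mul_rpow hr.le (by positivity), Real.mul_rpow hτ0.le (by positivity), hN, hq, mul_pow,
            ← Real.rpow_pow_comm (by norm_num), ← Real.rpow_pow_comm hlam0.le]
          have h2p : (0:ℝ) < 2 ^ p := by positivity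
          have h4p : (0:ℝ) < 4 ^ p := by positivity
          have hdp : (0:ℝ) < d ^ p := by positivity
          rw [inv_pow]
          exact dg_alg _ _ _ _ _ _ _ h4p.ne' hdp.ne' (pow_pos h2p j).ne')
      refine hst.trans ((mul_le_mul' le_rfl ih).trans ?_)
      rw [← ENNReal.ofReal_mul (by positivity)]
      apply ENNReal.ofReal_le_ofReal
      have e5 : C * (1 + A) * (2 * (4 * 2 ^ j)) ^ m * (r * (τ * lam ^ j) / r) ^ (s * p)
          = C * (1 + A) * 8 ^ m * τ ^ (s * p) := by
        rw [mul_div_cancel_left₀ _ hr.ne', ← mul_assoc 2, Real.mul_rpow (by norm_num) h2j0.le,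
          Real.mul_rpow hτ0.le (by positivity), ← Real.rpow_pow_comm (by norm_num), ← Real.rpow_pow_comm hlam0.le]
        have : (lam ^ (s * p)) ^ j * ((2:ℝ) ^ m) ^ j = 1 := by rw [← mul_pow, hlamsp, one_pow]
        norm_num
        linear_combination (C * (1 + A) * 8 ^ m * τ ^ (s * p)) * this
      rw [e5]
      calc C * (1 + A) * 8 ^ m * τ ^ (s * p) * (N * q ^ j * d ^ p * r ^ (n:ℝ))
          ≤ q * (N * q ^ j * d ^ p * r ^ (n:ℝ)) := mul_le_mul_of_nonneg_right hτq (by positivity)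
        _ = _ := by rw [pow_succ]; ring
  have hz : ∫⁻ x in ball x0 (r/2), ENNReal.ofReal (max (f x - d) 0 ^ p) = 0 := by
    apply le_antisymm _ bot_le
    have hlim : Tendsto (fun j : ℕ => ENNReal.ofReal (N * q ^ j * d ^ p * r ^ (n:ℝ))) atTop (𝓝 0) := by
      have h1 : Tendsto (fun j : ℕ => N * q ^ j * d ^ p * r ^ (n:ℝ)) atTop (𝓝 (N * 0 * d ^ p * r ^ (n:ℝ))) :=
        (((tendsto_pow_atTop_nhds_zero_of_lt_one hq0.le hq1).const_mul N).mul_const _).mul_const _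
      have := ENNReal.tendsto_ofReal h1
      simpa using this
    refine ge_of_tendsto' hlim fun j => le_trans ?_ (claim j)
    refine (lintegral_mono_set (ball_subset_ball (?_ : r/2 ≤ r/2 + r/2 * (1/2)^j))).trans (lintegral_mono fun x => ?_)
    · have : 0 ≤ r/2 * (1/2)^j := by positivity
      linarith
    · apply ENNReal.ofReal_le_ofReal
      apply Real.rpow_le_rpow (by positivity) _ (by linarith)
      apply max_le_max _ le_rfl
      have : 0 ≤ d * (1/2)^j := by positivity
      linarith
  rw [lintegral_eq_zero_iff (by fun_prop)] at hz
  have hz' := (ae_restrict_iff' measurableSet_ball).1 hz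
  filter_upwards [hz'] with x hx hxb
  have h1 := hx hxb
  simp only [Pi.zero_apply, ENNReal.ofReal_eq_zero] at h1
  by_contra h
  push Not at h
  rw [max_eq_left (by linarith)] at h1
  have := Real.rpow_pos_of_pos (sub_pos.2 h) p
  linarith

lemma Sub0.mono {n : ℕ} {p : ℝ} {K : Euc n → Euc n → ℝ} {f : Euc n → ℝ} {x0 : Euc n} {r r' : ℝ}
    (h : Sub0 n p K f x0 r) (hr : r' ≤ r) : Sub0 n p K f x0 r' :=
  fun η ρ l h1 h2 => h η ρ l h1 (h2.trans_le hr)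

lemma lint_ball_bound {n : ℕ} (hn : 1 ≤ n) {x0 : Euc n} {r c : ℝ} (hr : 0 ≤ r) (hc : 0 ≤ c) {F : Euc n → ℝ}
    (h : ∀ᵐ x, x ∈ ball x0 r → F x ≤ c) :
    ∫⁻ x in ball x0 r, ENNReal.ofReal (F x) ≤ ENNReal.ofReal (c * (r ^ (n:ℝ) * vb n)) := by
  calc ∫⁻ x in ball x0 r, ENNReal.ofReal (F x) ≤ ∫⁻ x in ball x0 r, ENNReal.ofReal c := by
        refine lintegral_mono_ae ((ae_restrict_iff' measurableSet_ball).2 ?_)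
        filter_upwards [h] with x hx hxb
        exact ENNReal.ofReal_le_ofReal (hx hxb)
    _ = _ := by
        rw [lintegral_const, Measure.restrict_apply_univ, vol_ball hn x0 hr, ← ENNReal.ofReal_mul hc]

lemma lemD_low {n : ℕ} {s p : ℝ} (hs0 : 0 < s) (hp : 1 < p) {f η : Euc n → ℝ} (hf : Measurable f)
    (hη0 : ∀ x, 0 ≤ η x) {x0 : Euc n} {r ω : ℝ} (hr : 0 < r) (hω : 0 < ω) (hη : ∀ x ∈ ball x0 r, η x = 1)
    (hvol : ENNReal.ofReal (r ^ (n:ℝ) * vb n / 2) ≤ volume (ball x0 r ∩ {x | f x ≤ -ω / 4})) :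
    ENNReal.ofReal ((ω/4) ^ (p-1) * (2 * r) ^ (-((n:ℝ) + s * p)) * (r ^ (n:ℝ) * vb n / 2)) *
      (∫⁻ x in ball x0 r, ENNReal.ofReal (max (f x) 0)) ≤
    ∫⁻ z in ball x0 (2*r) ×ˢ ball x0 (2*r), ENNReal.ofReal
      ((|η z.1 * max (f z.1) 0 - η z.2 * max (f z.2) 0| ^ p
        + η z.1 ^ p * max (f z.1) 0 * max (-f z.2) 0 ^ (p-1)) * ‖z.1 - z.2‖ ^ (-((n:ℝ) + s * p))) := by
  have hκ : 0 ≤ (n:ℝ) + s * p := by positivity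
  set κ := (n:ℝ) + s * p
  set S := ball x0 r ∩ {x | f x ≤ -ω / 4} with hS
  have hSm : MeasurableSet S := measurableSet_ball.inter (measurableSet_le hf measurable_const)
  have hsub : ball x0 r ×ˢ S ⊆ ball x0 (2*r) ×ˢ ball x0 (2*r) :=
    Set.prod_mono (ball_subset_ball (by linarith)) (Set.inter_subset_left.trans (ball_subset_ball (by linarith)))
  refine le_trans ?_ (lintegral_mono_set hsub)
  calc _ ≤ ENNReal.ofReal ((ω/4) ^ (p-1) * (2 * r) ^ (-κ)) * ((∫⁻ x in ball x0 r, ENNReal.ofReal (max (f x) 0)) * volume S) := by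
        rw [ENNReal.ofReal_mul (by positivity), mul_assoc, mul_comm (ENNReal.ofReal (r ^ (n:ℝ) * vb n / 2))]
        gcongr
    _ = ∫⁻ z in ball x0 r ×ˢ S, ENNReal.ofReal ((ω/4) ^ (p-1) * (2 * r) ^ (-κ)) * (ENNReal.ofReal (max (f z.1) 0) * 1) := by
        rw [lintegral_const_mul' _ _ ENNReal.ofReal_ne_top, Measure.volume_eq_prod, ← Measure.prod_restrict,
          lintegral_prod_mul (f := fun x => ENNReal.ofReal (max (f x) 0)) (g := fun _ => 1) (by fun_prop) (by fun_prop)]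
        simp
    _ ≤ _ := by
        refine setLIntegral_mono' (measurableSet_ball.prod hSm) fun z hz => ?_
        rw [mul_one, ← ENNReal.ofReal_mul (by positivity)]
        apply ENNReal.ofReal_le_ofReal
        obtain ⟨x, y⟩ := z
        obtain ⟨hx, hy, hfy⟩ := hz
        simp only at hx hy hfy ⊢
        have hfy : f y ≤ -ω/4 := hfy
        rw [hη x hx, Real.one_rpow, one_mul, max_eq_left (by linarith : 0 ≤ -f y)]
        have h1 : (ω / 4) ^ (p-1) ≤ (-f y) ^ (p-1) := Real.rpow_le_rpow (by positivity) (by linarith) (by linarith)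
        have h2 : max (f x) 0 * (2 * r) ^ (-κ) ≤ max (f x) 0 * ‖x - y‖ ^ (-κ) := by
          by_cases hxy : x = y
          · subst hxy
            rw [max_eq_right (by linarith), zero_mul, zero_mul]
          · apply mul_le_mul_of_nonneg_left _ (le_max_right _ _)
            apply Real.rpow_le_rpow_of_nonpos (norm_pos_iff.2 (sub_ne_zero.2 hxy)) _ (by linarith)
            have h3 : dist x x0 < r := hx
            have h4 : dist y x0 < r := hy
            have := dist_triangle_right x y x0
            rw [← dist_eq_norm]; linarith
        have h5 : 0 ≤ |max (f x) 0 - η y * max (f y) 0| ^ p * ‖x - y‖ ^ (-κ) := by positivity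
        have h6 : 0 ≤ (-f y) ^ (p-1) := by apply Real.rpow_nonneg; linarith
        calc _ = (ω / 4) ^ (p-1) * (max (f x) 0 * (2 * r) ^ (-κ)) := by ring
          _ ≤ (-f y) ^ (p-1) * (max (f x) 0 * ‖x - y‖ ^ (-κ)) := mul_le_mul h1 h2 (by positivity) h6
          _ ≤ _ := by linarith

lemma lemD_alg {C M δ θ ω r vb n sp κ p T1 T2 : ℝ} (hC : 0 < C) (hω : 0 < ω) (hθ : 0 < θ) (hr : 0 < r) (hvb : 0 < vb)
    (hδ : δ = θ * ω) (hκ : κ = n + sp) (hT : T1 + T2 ≤ C * M * (δ ^ p * r ^ (n - sp) * vb)) :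
    (T1 + T2) / ((ω/4) ^ (p-1) * (2 * r) ^ (-κ) * (r ^ n * vb / 2)) ≤
      C * M * 4 ^ (p-1) * 2 ^ κ * 2 * (θ ^ (p-1) * δ * r ^ n) := by
  rw [div_le_iff₀ (by positivity)]
  refine hT.trans (le_of_eq ?_)
  have hδ0 : 0 < δ := by rw [hδ]; positivity
  have e1 : δ ^ p = θ ^ (p-1) * ω ^ (p-1) * δ := by
    rw [← Real.mul_rpow hθ.le hω.le, ← hδ]
    nth_rewrite 3 [← Real.rpow_one δ]
    rw [← Real.rpow_add hδ0]; congr 1; ring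
  rw [e1, Real.div_rpow hω.le (by norm_num), Real.mul_rpow (by norm_num) hr.le, Real.rpow_neg (by norm_num)]
  have e2 : r ^ (n - sp) = r ^ n * r ^ (-κ) * r ^ n := by
    rw [← Real.rpow_add hr, ← Real.rpow_add hr, hκ]; congr 1; ring
  rw [e2]
  have a1 : (4:ℝ) ^ (p-1) ≠ 0 := by positivity
  have a2 : (2:ℝ) ^ κ ≠ 0 := by positivity
  field_simp

set_option maxHeartbeats 1000000 in
lemma lemD {n : ℕ} (hn : 1 ≤ n) {s p Λ : ℝ} (hs0 : 0 < s) (hs1 : s < 1) (hp : 1 < p) (hΛ : 1 ≤ Λ) (A : ℝ) (hA : 0 ≤ A) :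
    ∃ θ : ℝ, 0 < θ ∧ θ ≤ 1/4 ∧ ∀ (K : Euc n → Euc n → ℝ) (_ : IsKernel n s p Λ K) (f : Euc n → ℝ) (_ : Measurable f)
    (x0 : Euc n) (r ω : ℝ) (_ : 0 < r) (_ : 0 < ω)
    (_ : ∀ k, 0 ≤ k → Sub0 n p K (fun x => f x - k) x0 (2*r))
    (_ : ∀ᵐ x, x ∈ ball x0 (2*r) → f x ≤ θ * ω)
    (_ : tl n s p f x0 (r/2) ≤ ENNReal.ofReal (A * (θ * ω) ^ (p-1) * r ^ (-(s*p))))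
    (_ : ENNReal.ofReal (r ^ (n:ℝ) * vb n / 2) ≤ volume (ball x0 r ∩ {x | f x ≤ -ω / 4})),
    ∀ᵐ x, x ∈ ball x0 (r/2) → f x ≤ θ * ω / 2 := by
  obtain ⟨C, hC, hcacc⟩ := cacc2 hn hs0 hs1 hp hΛ
  obtain ⟨ν, hν, hB⟩ := lemB hn hs0 hs1 hp hΛ (A * 2 ^ (p-1)) (by positivity)
  have hvb := vb_pos n
  set κ := (n:ℝ) + s * p with hκ
  have hκ0 : 0 ≤ κ := by positivity
  set M : ℝ := 2 ^ p * 2 ^ (p - s * p) * 2 ^ (n:ℝ) + 4 ^ κ * 2 ^ (n:ℝ) * A with hM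
  have hM0 : 0 < M := by positivity
  set C2 : ℝ := C * M * 4 ^ (p-1) * 2 ^ κ * 2 with hC2
  have hC20 : 0 < C2 := by positivity
  set θ : ℝ := min (1/4) ((ν * (2 ^ p)⁻¹ / C2) ^ (1 / (p-1))) with hθ
  have hp1 : 0 < p - 1 := by linarith
  have hθ0 : 0 < θ := by apply lt_min (by norm_num); positivity
  have hθC : C2 * θ ^ (p-1) ≤ ν * (2 ^ p)⁻¹ := by
    have h1 : θ ^ (p-1) ≤ ν * (2 ^ p)⁻¹ / C2 := by
      calc θ ^ (p-1) ≤ ((ν * (2 ^ p)⁻¹ / C2) ^ (1 / (p-1))) ^ (p-1) :=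
            Real.rpow_le_rpow hθ0.le (min_le_right _ _) hp1.le
        _ = _ := by rw [← Real.rpow_mul (by positivity), one_div_mul_cancel hp1.ne', Real.rpow_one]
    rw [le_div_iff₀ hC20] at h1
    linarith
  refine ⟨θ, hθ0, min_le_left _ _, ?_⟩
  intro K hK f hf x0 r ω hr hω hsub hle htl hvol
  set δ := θ * ω with hδ
  have hδ0 : 0 < δ := by positivity
  have hsub0 : Sub0 n p K f x0 (2*r) := by simpa using hsub 0 le_rfl
  obtain ⟨η, l, hl, hlip, hη0, hη1, hηa, hηb⟩ := cutoff x0 (a := r) (b := 3 * r / 2) (by linarith)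
  have hc := hcacc K hK f hf x0 (2*r) (3*r/2) (2*r) hsub0 (by linarith) (by linarith) le_rfl η l hlip hη0 hη1 hηb
  have hlow := lemD_low (s := s) hs0 hp hf hη0 hr hω hηa hvol
  set I := ∫⁻ x in ball x0 r, ENNReal.ofReal (max (f x) 0) with hI
  have hle' : ∀ᵐ x, x ∈ ball x0 (2*r) → max (f x) 0 ≤ δ := by
    filter_upwards [hle] with x hx hxb
    exact max_le (hx hxb) hδ0.le
  have B1 : ∫⁻ x in ball x0 (2*r), ENNReal.ofReal (max (f x) 0 ^ p) ≤ ENNReal.ofReal (δ ^ p * ((2*r) ^ (n:ℝ) * vb n)) := by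
    apply lint_ball_bound hn (by positivity) (by positivity)
    filter_upwards [hle'] with x hx hxb
    exact Real.rpow_le_rpow (le_max_right _ _) (hx hxb) (by linarith)
  have B2 : ∫⁻ x in ball x0 (3*r/2), ENNReal.ofReal (max (f x) 0) ≤ ENNReal.ofReal (δ * ((2*r) ^ (n:ℝ) * vb n)) := by
    refine (lintegral_mono_set (ball_subset_ball (by linarith : 3*r/2 ≤ 2 * r))).trans ?_
    exact lint_ball_bound hn (by positivity) (by positivity) hle'
  have B3 : tl n s p f x0 (2*r) ≤ ENNReal.ofReal (A * δ ^ (p-1) * r ^ (-(s*p))) :=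
    (tl_mono hp (by linarith) (fun x => le_rfl)).trans htl
  have hU : ENNReal.ofReal ((ω/4) ^ (p-1) * (2 * r) ^ (-κ) * (r ^ (n:ℝ) * vb n / 2)) * I ≤
      ENNReal.ofReal (C * ((l:ℝ) ^ p * (2*r) ^ (p - s * p)) * (δ ^ p * ((2*r) ^ (n:ℝ) * vb n)) +
        C * (2 * r / (2 * r - 3 * r / 2)) ^ κ * (δ * ((2*r) ^ (n:ℝ) * vb n) * (A * δ ^ (p-1) * r ^ (-(s*p))))) := by
    refine (hlow.trans hc).trans ?_
    have h0 : 0 < 2 * r - 3 * r / 2 := by linarith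
    rw [ENNReal.ofReal_add (by positivity) (by positivity), ENNReal.ofReal_mul (p := C * ((l:ℝ) ^ p * (2*r) ^ (p - s * p))) (by positivity),
      ENNReal.ofReal_mul (p := C * (2 * r / (2 * r - 3 * r / 2)) ^ κ) (by positivity),
      ENNReal.ofReal_mul (p := δ * ((2*r) ^ (n:ℝ) * vb n)) (by positivity)]
    exact add_le_add (mul_le_mul' le_rfl B1) (mul_le_mul' le_rfl (mul_le_mul' B2 B3))
  have hI2 : I ≤ ENNReal.ofReal (C2 * (θ ^ (p-1) * δ * r ^ (n:ℝ))) := by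
    have ha : 0 < (ω/4) ^ (p-1) * (2 * r) ^ (-κ) * (r ^ (n:ℝ) * vb n / 2) := by positivity
    have h1 : I ≤ ENNReal.ofReal ((C * ((l:ℝ) ^ p * (2*r) ^ (p - s * p)) * (δ ^ p * ((2*r) ^ (n:ℝ) * vb n)) +
        C * (2 * r / (2 * r - 3 * r / 2)) ^ κ * (δ * ((2*r) ^ (n:ℝ) * vb n) * (A * δ ^ (p-1) * r ^ (-(s*p)))))/
        ((ω/4) ^ (p-1) * (2 * r) ^ (-κ) * (r ^ (n:ℝ) * vb n / 2))) := by
      rw [ENNReal.ofReal_div_of_pos ha, ENNReal.le_div_iff_mul_le (Or.inl (by simpa using ha)) (Or.inl ENNReal.ofReal_ne_top), mul_comm]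
      exact hU
    refine h1.trans (ENNReal.ofReal_le_ofReal ?_)
    refine lemD_alg (sp := s * p) hC hω hθ0 hr hvb hδ hκ (le_of_eq ?_)
    have e1 : (l:ℝ) = 2 / r := by
      rw [hl]; field_simp; ring
    have e2 : 2 * r / (2 * r - 3 * r / 2) = 4 := by
      rw [div_eq_iff (by linarith)]; ring
    have e3 : δ ^ p = δ ^ (p-1) * δ := (rpow_pm1_mul hp hδ0.le).symm
    rw [e1, e2, hM, Real.mul_rpow (by norm_num) hr.le, Real.mul_rpow (by norm_num) hr.le, Real.div_rpow (by norm_num) hr.le,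
      sub_eq_add_neg (n:ℝ), Real.rpow_add hr (n:ℝ), sub_eq_add_neg p, Real.rpow_add hr, e3]
    have : r ^ p ≠ 0 := by positivity
    field_simp
    try ring
  have hfin : ∫⁻ x in ball x0 r, ENNReal.ofReal (max (f x) 0 ^ p) ≤ ENNReal.ofReal (ν * (δ/2) ^ p * r ^ (n:ℝ)) := by
    calc ∫⁻ x in ball x0 r, ENNReal.ofReal (max (f x) 0 ^ p) ≤ ∫⁻ x in ball x0 r, ENNReal.ofReal (δ ^ (p-1)) * ENNReal.ofReal (max (f x) 0) := by
          refine lintegral_mono_ae ((ae_restrict_iff' measurableSet_ball).2 ?_)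
          filter_upwards [hle'] with x hx hxb
          rw [← ENNReal.ofReal_mul (by positivity)]
          apply ENNReal.ofReal_le_ofReal
          rw [← rpow_pm1_mul hp (le_max_right _ _)]
          apply mul_le_mul_of_nonneg_right _ (le_max_right _ _)
          exact Real.rpow_le_rpow (le_max_right _ _) (hx (ball_subset_ball (by linarith) hxb)) (by linarith)
      _ = ENNReal.ofReal (δ ^ (p-1)) * I := lintegral_const_mul' _ _ ENNReal.ofReal_ne_top
      _ ≤ ENNReal.ofReal (δ ^ (p-1)) * ENNReal.ofReal (C2 * (θ ^ (p-1) * δ * r ^ (n:ℝ))) := mul_le_mul' le_rfl hI2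
      _ ≤ _ := by
          rw [← ENNReal.ofReal_mul (by positivity)]
          apply ENNReal.ofReal_le_ofReal
          calc δ ^ (p-1) * (C2 * (θ ^ (p-1) * δ * r ^ (n:ℝ))) = (C2 * θ ^ (p-1)) * (δ ^ (p-1) * δ * r ^ (n:ℝ)) := by ring
            _ ≤ (ν * (2 ^ p)⁻¹) * (δ ^ (p-1) * δ * r ^ (n:ℝ)) := mul_le_mul_of_nonneg_right hθC (by positivity)
            _ = _ := by rw [rpow_pm1_mul hp hδ0.le, Real.div_rpow hδ0.le (by norm_num)]; ring
  refine hB K hK f hf x0 r (δ/2) hr (by positivity) (fun k hk => (hsub k hk).mono (by linarith)) ?_ hfin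
  refine htl.trans (le_of_eq ?_)
  congr 1
  rw [Real.div_rpow hδ0.le (by norm_num)]
  have : (2:ℝ) ^ (p-1) ≠ 0 := by positivity
  field_simp

lemma div_rpow_eq {n : ℕ} (z : Euc n × Euc n) (a κ : ℝ) :
    a / ‖z.1 - z.2‖ ^ κ = a * ‖z.1 - z.2‖ ^ (-κ) := by
  rw [Real.rpow_neg (norm_nonneg _), div_eq_mul_inv]

lemma pow_diff_le {p a b : ℝ} (hp : 1 < p) (ha : 0 ≤ a) (ha1 : a ≤ 1) (hb : 0 ≤ b) (hb1 : b ≤ 1) :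
    |a ^ p - b ^ p| ≤ p * |a - b| := by
  wlog h : b ≤ a generalizing a b with H
  · rw [abs_sub_comm, abs_sub_comm a]
    exact H hb hb1 ha ha1 (le_of_not_ge h)
  have h1 := rpow_sub_le hp hb h
  have h2 : b ^ p ≤ a ^ p := Real.rpow_le_rpow hb h (by linarith)
  rw [abs_of_nonneg (by linarith), abs_of_nonneg (by linarith)]
  have h3 : a ^ (p-1) ≤ 1 := Real.rpow_le_one ha ha1 (by linarith)
  have h4 : 0 ≤ a - b := by linarith
  calc _ ≤ _ := h1
    _ ≤ p * 1 * (a - b) := by gcongr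
    _ = _ := by ring

lemma phi_diff {p a b x y : ℝ} (hp : 1 < p) (ha : 0 ≤ a) (ha1 : a ≤ 1) (hb : 0 ≤ b) (hb1 : b ≤ 1) :
    |a ^ p * max x 0 - b ^ p * max y 0| ^ p ≤ 2 ^ p * (|x - y| ^ p + p ^ p * (max y 0 ^ p * |a - b| ^ p)) := by
  have h1 : |a ^ p * max x 0 - b ^ p * max y 0| ≤ |x - y| + p * (max y 0 * |a - b|) := by
    have e : a ^ p * max x 0 - b ^ p * max y 0 = a ^ p * (max x 0 - max y 0) + max y 0 * (a ^ p - b ^ p) := by ring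
    rw [e]
    refine (abs_add_le _ _).trans (add_le_add ?_ ?_)
    · rw [abs_mul, abs_of_nonneg (by positivity)]
      have h2 : a ^ p ≤ 1 := Real.rpow_le_one ha ha1 (by linarith)
      have h3 : |max x 0 - max y 0| ≤ |x - y| := abs_max_sub_max_le_abs x y 0
      calc a ^ p * |max x 0 - max y 0| ≤ 1 * |x - y| := by gcongr
        _ = _ := one_mul _
    · rw [abs_mul, abs_of_nonneg (le_max_right _ _)]
      have := pow_diff_le hp ha ha1 hb hb1
      calc max y 0 * |a ^ p - b ^ p| ≤ max y 0 * (p * |a - b|) := by gcongr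
        _ = _ := by ring
  calc _ ≤ (|x - y| + p * (max y 0 * |a - b|)) ^ p := Real.rpow_le_rpow (abs_nonneg _) h1 (by linarith)
    _ ≤ 2 ^ p * (|x - y| ^ p + (p * (max y 0 * |a - b|)) ^ p) := add_rpow_le_two (by linarith) (by positivity) (by positivity)
    _ = _ := by
      rw [Real.mul_rpow (by linarith) (by positivity), Real.mul_rpow (by positivity) (by positivity)]

/-- the test function is in the Sobolev space -/
lemma memW_phi {n : ℕ} (hn : 1 ≤ n) {s p : ℝ} (hs1 : s < 1) (hp : 1 < p) {Ω' : Set (Euc n)}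
    (hΩ' : MeasurableSet Ω') (hb : Bornology.IsBounded Ω') {w : Euc n → ℝ} (hw : Measurable w) (hW : MemW n s p Ω' w)
    {η : Euc n → ℝ} {l : NNReal} (hl : LipschitzWith l η) (hη0 : ∀ x, 0 ≤ η x) (hη1 : ∀ x, η x ≤ 1) :
    MemW n s p Ω' (fun x => η x ^ p * max (w x) 0) := by
  have hηm : Measurable η := hl.continuous.measurable
  refine ⟨by fun_prop, ?_, ?_⟩
  · refine Integrable.mono' hW.2.1 (Measurable.aestronglyMeasurable (by fun_prop)) (Eventually.of_forall fun x => ?_)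
    rw [Real.norm_eq_abs, abs_of_nonneg (by positivity)]
    apply Real.rpow_le_rpow (abs_nonneg _) _ (by linarith)
    rw [abs_mul, abs_of_nonneg (Real.rpow_nonneg (hη0 x) _), abs_of_nonneg (le_max_right _ _)]
    have h2 : η x ^ p ≤ 1 := Real.rpow_le_one (hη0 x) (hη1 x) (by linarith)
    calc η x ^ p * max (w x) 0 ≤ 1 * |w x| := by
          apply mul_le_mul h2 (max_le (le_abs_self _) (abs_nonneg _)) (le_max_right _ _) zero_le_one
      _ = _ := one_mul _
  · obtain ⟨C, hC, ht⟩ := cacc_t1 hn hs1 hp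
    obtain ⟨R, hR0, hR⟩ := hb.subset_ball_lt 0 (0 : Euc n)
    have hf1 : Measurable (fun z : Euc n × Euc n => w z.1) := hw.comp measurable_fst
    have hf2 : Measurable (fun z : Euc n × Euc n => w z.2) := hw.comp measurable_snd
    have hη1' : Measurable (fun z : Euc n × Euc n => η z.1) := hηm.comp measurable_fst
    have hη2' : Measurable (fun z : Euc n × Euc n => η z.2) := hηm.comp measurable_snd
    set κ := (n:ℝ) + s * p with hκ
    have hG : Integrable (fun z : Euc n × Euc n => max (w z.2) 0 ^ p * |η z.1 - η z.2| ^ p * ‖z.1 - z.2‖ ^ (-κ))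
      ((volume.restrict Ω').prod (volume.restrict Ω')) := by
      refine ⟨by fun_prop, ?_⟩
      rw [hasFiniteIntegral_iff_ofReal (Eventually.of_forall fun z => by positivity)]
      have h1 := ht (Ω'.indicator w) (hw.indicator hΩ') 0 R hR0 η l hl
      have h2 : ∫⁻ x in ball 0 R, ENNReal.ofReal (max (Ω'.indicator w x) 0 ^ p) < ⊤ := by
        calc ∫⁻ x in ball 0 R, ENNReal.ofReal (max (Ω'.indicator w x) 0 ^ p)
            ≤ ∫⁻ x, Ω'.indicator (fun x => ENNReal.ofReal (|w x| ^ p)) x := by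
              refine (setLIntegral_le_lintegral _ _).trans (lintegral_mono fun x => ?_)
              by_cases hx : x ∈ Ω'
              · simp only [Set.indicator_of_mem hx]
                apply ENNReal.ofReal_le_ofReal
                apply Real.rpow_le_rpow (le_max_right _ _) (max_le (le_abs_self _) (abs_nonneg _)) (by linarith)
              · simp only [Set.indicator_of_notMem hx, max_self, Real.zero_rpow (by linarith : p ≠ 0)]; simp
          _ = ∫⁻ x in Ω', ENNReal.ofReal (|w x| ^ p) := lintegral_indicator hΩ' _
          _ < ⊤ := by
              have := hW.2.1.2
              rwa [hasFiniteIntegral_iff_ofReal (Eventually.of_forall fun x => by positivity)] at this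
      refine lt_of_le_of_lt ?_ (lt_of_le_of_lt h1 (ENNReal.mul_lt_top ENNReal.ofReal_lt_top h2))
      rw [Measure.prod_restrict, ← Measure.volume_eq_prod]
      refine le_trans ?_ (lintegral_mono_set (Set.prod_mono hR hR))
      refine setLIntegral_mono' (hΩ'.prod hΩ') fun z hz => ?_
      apply ENNReal.ofReal_le_ofReal
      rw [Set.indicator_of_mem hz.1, Set.indicator_of_mem hz.2, mul_assoc, mul_assoc]
      apply mul_le_mul_of_nonneg_right _ (by positivity)
      have : 0 ≤ max (w z.1) 0 ^ p := by positivity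
      linarith
    refine Integrable.mono' ((hW.2.2.const_mul (2 ^ p)).add (hG.const_mul (2 ^ p * p ^ p))) ?_ (Eventually.of_forall fun z => ?_)
    · have : Measurable (fun q : Euc n × Euc n => |η q.1 ^ p * max (w q.1) 0 - η q.2 ^ p * max (w q.2) 0| ^ p / ‖q.1 - q.2‖ ^ κ) := by
        fun_prop
      exact this.aestronglyMeasurable
    · rw [Real.norm_eq_abs, abs_of_nonneg (by positivity)]
      have := phi_diff hp (x := w z.1) (y := w z.2) (hη0 z.1) (hη1 z.1) (hη0 z.2) (hη1 z.2)
      simp only [Pi.add_apply, div_rpow_eq]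
      calc _ ≤ 2 ^ p * (|w z.1 - w z.2| ^ p + p ^ p * (max (w z.2) 0 ^ p * |η z.1 - η z.2| ^ p)) * ‖z.1 - z.2‖ ^ (-κ) :=
            mul_le_mul_of_nonneg_right this (by positivity)
        _ = _ := by ring

lemma young_simple {p a b : ℝ} (hp : 1 < p) (ha : 0 ≤ a) (hb : 0 ≤ b) : a ^ (p-1) * b ≤ a ^ p + b ^ p := by
  rcases le_total a b with h | h
  · have : a ^ (p-1) * b ≤ b ^ (p-1) * b := mul_le_mul_of_nonneg_right (Real.rpow_le_rpow ha h (by linarith)) hb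
    rw [rpow_pm1_mul hp hb] at this
    have : 0 ≤ a ^ p := by positivity
    linarith
  · have : a ^ (p-1) * b ≤ a ^ (p-1) * a := mul_le_mul_of_nonneg_left h (by positivity)
    rw [rpow_pm1_mul hp ha] at this
    have : 0 ≤ b ^ p := by positivity
    linarith

lemma int_far {n : ℕ} {s p : ℝ} (hs0 : 0 < s) (hp : 1 < p) (x0 : Euc n) {r : ℝ} (hr : 0 < r) :
    IntegrableOn (fun y : Euc n => ‖y - x0‖ ^ (-((n:ℝ) + s * p))) (ball x0 r)ᶜ volume := by
  obtain ⟨C, hC, h⟩ := far_bound (n := n) (a := (n:ℝ) + s * p) (lt_add_of_pos_right _ (by positivity))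
  refine ⟨Measurable.aestronglyMeasurable (by fun_prop), ?_⟩
  rw [hasFiniteIntegral_iff_ofReal (Eventually.of_forall fun z => by positivity)]
  exact lt_of_le_of_lt (h x0 r hr) ENNReal.ofReal_lt_top

lemma int_sub_pow {n : ℕ} {s p : ℝ} {Ω' : Set (Euc n)}
    (hb : Bornology.IsBounded Ω') {w : Euc n → ℝ} (hw : Measurable w) (hW : MemW n s p Ω' w) {q : ℝ} (hq0 : 0 ≤ q) (hq : q ≤ p) :
    IntegrableOn (fun x => |w x| ^ q) Ω' volume := by
  have hfin : IsFiniteMeasure (volume.restrict Ω') := ⟨by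
    rw [Measure.restrict_apply_univ]; exact hb.measure_lt_top⟩
  refine Integrable.mono' ((integrable_const (1:ℝ)).add hW.2.1) (by fun_prop) (Eventually.of_forall fun x => ?_)
  rw [Real.norm_eq_abs, abs_of_nonneg (by positivity)]
  simp only [Pi.add_apply]
  rcases le_total (|w x|) 1 with h | h
  · have : |w x| ^ q ≤ 1 := Real.rpow_le_one (abs_nonneg _) h hq0
    have : 0 ≤ |w x| ^ p := by positivity
    linarith
  · have := Real.rpow_le_rpow_of_exponent_le h hq
    linarith

set_option maxHeartbeats 1000000 in
lemma int_F {n : ℕ} {s p Λ : ℝ} (hs0 : 0 < s) (hp : 1 < p) (hΛ : 1 ≤ Λ)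
    {K : Euc n → Euc n → ℝ} (hK : IsKernel n s p Λ K) {Ω' : Set (Euc n)}
    (hΩ' : MeasurableSet Ω') (hb : Bornology.IsBounded Ω') {w : Euc n → ℝ} (hw : Measurable w) (hW : MemW n s p Ω' w)
    {x0 : Euc n} {r ρ : ℝ} (hρ : 0 < ρ) (hρr : ρ < r) (hball : ball x0 r ⊆ Ω')
    (htail : IntegrableOn (fun y => |w y| ^ (p-1) * ‖y - x0‖ ^ (-((n:ℝ) + s * p))) (ball x0 r)ᶜ volume)
    {φ : Euc n → ℝ} (hφm : Measurable φ) (hφW : MemW n s p Ω' φ) (hφs : ∀ x, x ∉ ball x0 ρ → φ x = 0) (hφw : ∀ x, |φ x| ≤ |w x|) :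
    Integrable (fun z : Euc n × Euc n => Lf p (w z.1) (w z.2) * (φ z.1 - φ z.2) * K z.1 z.2) := by
  set κ := (n:ℝ) + s * p with hκ
  have hκ0 : 0 ≤ κ := by positivity
  set F : Euc n × Euc n → ℝ := fun z => Lf p (w z.1) (w z.2) * (φ z.1 - φ z.2) * K z.1 z.2 with hF
  have hw1 : Measurable (fun z : Euc n × Euc n => w z.1) := hw.comp measurable_fst
  have hw2 : Measurable (fun z : Euc n × Euc n => w z.2) := hw.comp measurable_snd
  have hφ1 : Measurable (fun z : Euc n × Euc n => φ z.1) := hφm.comp measurable_fst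
  have hφ2 : Measurable (fun z : Euc n × Euc n => φ z.2) := hφm.comp measurable_snd
  have hKm : Measurable (fun z : Euc n × Euc n => K z.1 z.2) := hK.1
  have hFm : Measurable F := ((Lf_measurable hw1 hw2).mul (hφ1.sub hφ2)).mul hKm
  have hkb := kernel_bounds hs0 hp hΛ hK
  have hK0 : ∀ x y, 0 ≤ K x y := hK.2.2.1
  have hsymm : ∀ z, F z.swap = F z := by
    intro z
    simp only [hF, Prod.fst_swap, Prod.snd_swap]
    rw [Lf_swap, hK.2.1 z.2 z.1]; ring
  have hBΩ : ball x0 ρ ⊆ Ω' := (ball_subset_ball hρr.le).trans hball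
  -- inner part
  have I1 : IntegrableOn F (Ω' ×ˢ Ω') volume := by
    rw [IntegrableOn, Measure.volume_eq_prod, ← Measure.prod_restrict]
    refine Integrable.mono' ((hW.2.2.add hφW.2.2).const_mul Λ) hFm.aestronglyMeasurable ?_
    have hkb' : ∀ᵐ z ∂((volume.restrict Ω').prod (volume.restrict Ω')), K z.1 z.2 ≤ Λ * ‖z.1 - z.2‖ ^ (-κ) := by
      rw [Measure.prod_restrict, ← Measure.volume_eq_prod]
      exact ae_restrict_of_ae (hkb.mono fun z hz => hz.2)
    filter_upwards [hkb'] with z hz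
    simp only [hF, Pi.add_apply, div_rpow_eq]
    rw [Real.norm_eq_abs, abs_mul, abs_mul, abs_Lf hp, abs_of_nonneg (hK0 _ _)]
    have h1 := young_simple hp (abs_nonneg (w z.1 - w z.2)) (abs_nonneg (φ z.1 - φ z.2))
    calc _ ≤ (|w z.1 - w z.2| ^ p + |φ z.1 - φ z.2| ^ p) * (Λ * ‖z.1 - z.2‖ ^ (-κ)) :=
          mul_le_mul h1 hz (hK0 _ _) (by positivity)
      _ = _ := by ring
  -- outer part
  have I2 : IntegrableOn F (ball x0 ρ ×ˢ Ω'ᶜ) volume := by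
    have hsubc : Ω'ᶜ ⊆ (ball x0 r)ᶜ := Set.compl_subset_compl.2 hball
    have a1 : Integrable (fun x => |w x| ^ p) (volume.restrict (ball x0 ρ)) := hW.2.1.mono_set hBΩ
    have a2 : Integrable (fun x => |w x|) (volume.restrict (ball x0 ρ)) := by
      have := (int_sub_pow hb hw hW (q := 1) zero_le_one hp.le).mono_set hBΩ
      simp only [Real.rpow_one] at this
      exact this
    have b1 : Integrable (fun y : Euc n => ‖y - x0‖ ^ (-κ)) (volume.restrict Ω'ᶜ) :=
      (int_far hs0 hp x0 (hρ.trans hρr)).mono_set hsubc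
    have b2 : Integrable (fun y : Euc n => |w y| ^ (p-1) * ‖y - x0‖ ^ (-κ)) (volume.restrict Ω'ᶜ) :=
      htail.mono_set hsubc
    have c1 := a1.mul_prod b1
    have c2 := a2.mul_prod b2
    rw [IntegrableOn, Measure.volume_eq_prod, ← Measure.prod_restrict]
    refine Integrable.mono' ((c1.add c2).const_mul (2 ^ (p-1) * (Λ * (r / (r - ρ)) ^ κ))) hFm.aestronglyMeasurable ?_
    rw [Measure.prod_restrict, ← Measure.volume_eq_prod]
    rw [ae_restrict_iff' (measurableSet_ball.prod hΩ'.compl)]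
    filter_upwards [hkb] with z hz hzm
    have hd : 0 < r - ρ := by linarith
    have hr : 0 < r := by linarith
    have hfd := far_dist hκ0 hρ hρr hzm.1 (fun h => hzm.2 (hball h))
    have h2 : φ z.2 = 0 := hφs _ (fun h => hzm.2 (hBΩ h))
    simp only [hF, Pi.add_apply, h2, sub_zero]
    rw [Real.norm_eq_abs, abs_mul, abs_mul, abs_Lf hp, abs_of_nonneg (hK0 _ _)]
    have h3 : |w z.1 - w z.2| ^ (p-1) ≤ 2 ^ (p-1) * (|w z.1| ^ (p-1) + |w z.2| ^ (p-1)) :=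
      (Real.rpow_le_rpow (abs_nonneg _) (abs_sub _ _) (by linarith)).trans
        (add_rpow_le_two (by linarith) (abs_nonneg _) (abs_nonneg _))
    have h4 : K z.1 z.2 ≤ Λ * ((r / (r - ρ)) ^ κ * ‖z.2 - x0‖ ^ (-κ)) :=
      hz.2.trans (mul_le_mul_of_nonneg_left hfd (by linarith))
    calc |w z.1 - w z.2| ^ (p-1) * |φ z.1| * K z.1 z.2
        ≤ (2 ^ (p-1) * (|w z.1| ^ (p-1) + |w z.2| ^ (p-1)) * |w z.1|) * (Λ * ((r / (r - ρ)) ^ κ * ‖z.2 - x0‖ ^ (-κ))) := by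
          refine mul_le_mul (mul_le_mul h3 (hφw _) (abs_nonneg _) (by positivity)) h4 (hK0 _ _) (by positivity)
      _ = _ := by
          rw [← rpow_pm1_mul hp (abs_nonneg (w z.1))]; ring
  have I3 : IntegrableOn F (Ω'ᶜ ×ˢ ball x0 ρ) volume := by
    have := (integrable_swap_iff (f := F) (μ := volume.restrict Ω'ᶜ) (ν := volume.restrict (ball x0 ρ)))
    rw [IntegrableOn, Measure.volume_eq_prod, ← Measure.prod_restrict]
    rw [IntegrableOn, Measure.volume_eq_prod, ← Measure.prod_restrict] at I2
    have h2 := I2.swap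
    refine h2.congr (Eventually.of_forall fun z => ?_)
    exact hsymm z
  have I4 : IntegrableOn F ((Ω' ×ˢ Ω') ∪ (ball x0 ρ ×ˢ Ω'ᶜ) ∪ (Ω'ᶜ ×ˢ ball x0 ρ)) volume := (I1.union I2).union I3
  rw [← integrableOn_univ]
  refine I4.of_forall_sdiff_eq_zero MeasurableSet.univ fun z hz => ?_
  have hz' := hz.2
  simp only [Set.mem_union, Set.mem_prod, Set.mem_compl_iff, not_or, not_and] at hz'
  obtain ⟨⟨h1, h2⟩, h3⟩ := hz'
  have e1 : φ z.1 = 0 := by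
    apply hφs; intro h
    by_cases h' : z.2 ∈ Ω'
    · exact h1 (hBΩ h) h'
    · exact h2 h h'
  have e2 : φ z.2 = 0 := by
    apply hφs; intro h
    by_cases h' : z.1 ∈ Ω'
    · exact h1 h' (hBΩ h)
    · exact h3 h' h
  simp only [hF, e1, e2, sub_zero, mul_zero, zero_mul]

/-- the functional as a double integral over the whole space -/
lemma Aop_eq {n : ℕ} {p : ℝ} {K : Euc n → Euc n → ℝ} (hKs : ∀ x y, K x y = K y x) {Ω Ω' : Set (Euc n)}
    (hΩ : MeasurableSet Ω) (hΩ' : MeasurableSet Ω') (hsub : Ω ⊆ Ω') {g u w φ : Euc n → ℝ} (huw : ∀ᵐ x, u x = w x)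
    (hug : ∀ᵐ x, x ∉ Ω → u x = g x) (hφ : ∀ x, x ∉ Ω → φ x = 0)
    (hF : Integrable (fun z : Euc n × Euc n => Lf p (w z.1) (w z.2) * (φ z.1 - φ z.2) * K z.1 z.2)) :
    Aop n p Ω Ω' g K u φ = ∫ z : Euc n × Euc n, Lf p (w z.1) (w z.2) * (φ z.1 - φ z.2) * K z.1 z.2 := by
  set F : Euc n × Euc n → ℝ := fun z => Lf p (w z.1) (w z.2) * (φ z.1 - φ z.2) * K z.1 z.2 with hFd
  have hsymm : ∀ z, F z.swap = F z := by
    intro z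
    simp only [hFd, Prod.fst_swap, Prod.snd_swap]
    rw [Lf_swap, hKs z.2 z.1]; ring
  have hFv : Integrable F (volume.prod volume) := hF
  have e1 : (∫ x in Ω', ∫ y in Ω', Lf p (u x) (u y) * (φ x - φ y) * K x y) = ∫ z in Ω' ×ˢ Ω', F z := by
    rw [Measure.volume_eq_prod, setIntegral_prod _ hFv.integrableOn]
    refine setIntegral_congr_ae hΩ' ?_
    filter_upwards [huw] with x hx _
    refine setIntegral_congr_ae hΩ' ?_
    filter_upwards [huw] with y hy _
    simp only [hFd, hx, hy]
  have e2 : (∫ y in Ω'ᶜ, ∫ x in Ω, Lf p (u x) (g y) * φ x * K x y) = ∫ z in Ω'ᶜ ×ˢ Ω, F z := by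
    rw [Measure.volume_eq_prod, setIntegral_prod _ hFv.integrableOn]
    refine setIntegral_congr_ae hΩ'.compl ?_
    filter_upwards [huw, hug] with y hy hgy hyΩ
    have hyΩ2 : y ∉ Ω := fun h => hyΩ (hsub h)
    refine setIntegral_congr_ae hΩ ?_
    filter_upwards [huw] with x hx _
    have : g y = w y := by rw [← hgy hyΩ2, hy]
    simp only [hFd, hx, this, hφ y hyΩ2]
    rw [Lf_swap (a := w x) (b := w y), hKs y x]; ring
  have e3 : ∫ z in Ω ×ˢ Ω'ᶜ, F z = ∫ z in Ω'ᶜ ×ˢ Ω, F z := by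
    rw [Measure.volume_eq_prod, ← Measure.prod_restrict, ← Measure.prod_restrict,
      ← integral_prod_swap (μ := volume.restrict Ω) (ν := volume.restrict Ω'ᶜ)]
    exact integral_congr_ae (Eventually.of_forall fun z => (hsymm z))
  have e4 : ∫ z, F z = ∫ z in ((Ω' ×ˢ Ω') ∪ (Ω ×ˢ Ω'ᶜ)) ∪ (Ω'ᶜ ×ˢ Ω), F z := by
    symm
    apply setIntegral_eq_integral_of_forall_compl_eq_zero
    intro z hz
    simp only [Set.mem_union, Set.mem_prod, Set.mem_compl_iff, not_or, not_and] at hz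
    obtain ⟨⟨h1, h2⟩, h3⟩ := hz
    have e1 : φ z.1 = 0 := by
      apply hφ; intro h
      by_cases h' : z.2 ∈ Ω'
      · exact h1 (hsub h) h'
      · exact h2 h h'
    have e2 : φ z.2 = 0 := by
      apply hφ; intro h
      by_cases h' : z.1 ∈ Ω'
      · exact h1 h' (hsub h)
      · exact h3 h' h
    simp only [hFd, e1, e2, sub_zero, mul_zero, zero_mul]
  rw [e4, setIntegral_union _ (hΩ'.compl.prod hΩ) hF.integrableOn hF.integrableOn,
    setIntegral_union _ (hΩ.prod hΩ'.compl) hF.integrableOn hF.integrableOn, e3, Aop, e1, e2]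
  · ring
  · rw [Set.disjoint_left]
    rintro z ⟨h1, h2⟩ ⟨h3, h4⟩
    exact h4 h2
  · rw [Set.disjoint_left]
    rintro z h ⟨h3, h4⟩
    rcases h with h | h
    · exact h3 h.1
    · exact h3 (hsub h.1)

lemma memW_congr {n : ℕ} {s p : ℝ} {D : Set (Euc n)} {u v : Euc n → ℝ} (huv : ∀ᵐ x, u x = v x)
    (h : MemW n s p D u) : MemW n s p D v := by
  have h1 : ∀ᵐ x ∂(volume.restrict D), u x = v x := ae_restrict_of_ae huv
  refine ⟨h.1.congr h1, h.2.1.congr (h1.mono fun x hx => by simp only [hx]), h.2.2.congr ?_⟩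
  have a1 := Measure.quasiMeasurePreserving_fst (μ := volume.restrict D) (ν := volume.restrict D) |>.ae h1
  have a2 := Measure.quasiMeasurePreserving_snd (μ := volume.restrict D) (ν := volume.restrict D) |>.ae h1
  filter_upwards [a1, a2] with z hz1 hz2
  rw [hz1, hz2]

lemma memW_affine {n : ℕ} {s p : ℝ} (hp : 1 < p) {D : Set (Euc n)} (hb : Bornology.IsBounded D) {u : Euc n → ℝ}
    (hu : Measurable u) {σ : ℝ} (hσ : |σ| = 1) (k : ℝ)
    (h : MemW n s p D u) : MemW n s p D (fun x => σ * u x - k) := by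
  have hfin : IsFiniteMeasure (volume.restrict D) := ⟨by
    rw [Measure.restrict_apply_univ]; exact hb.measure_lt_top⟩
  refine ⟨by fun_prop, ?_, ?_⟩
  · refine Integrable.mono' ((h.2.1.add (integrable_const (|k| ^ p))).const_mul (2 ^ p))
      (Measurable.aestronglyMeasurable (by fun_prop)) (Eventually.of_forall fun x => ?_)
    rw [Real.norm_eq_abs, abs_of_nonneg (by positivity)]
    refine (Real.rpow_le_rpow (abs_nonneg _) (abs_sub _ _) (by linarith)).trans ?_
    rw [abs_mul, hσ, one_mul]
    exact add_rpow_le_two (by linarith) (abs_nonneg _) (abs_nonneg _)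
  · refine h.2.2.congr (Eventually.of_forall fun z => ?_)
    have : |σ * u z.1 - k - (σ * u z.2 - k)| = |u z.1 - u z.2| := by
      rw [show σ * u z.1 - k - (σ * u z.2 - k) = σ * (u z.1 - u z.2) by ring, abs_mul, hσ, one_mul]
    simp only [this]

lemma memW_add {n : ℕ} {s p : ℝ} (hp : 1 < p) {D : Set (Euc n)} {u v : Euc n → ℝ}
    (hum : Measurable u) (hvm : Measurable v)
    (hu : MemW n s p D u) (hv : MemW n s p D v) : MemW n s p D (fun x => u x + v x) := by
  refine ⟨by fun_prop, ?_, ?_⟩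
  · refine Integrable.mono' ((hu.2.1.add hv.2.1).const_mul (2 ^ p))
      (Measurable.aestronglyMeasurable (by fun_prop)) (Eventually.of_forall fun x => ?_)
    rw [Real.norm_eq_abs, abs_of_nonneg (by positivity)]
    exact (Real.rpow_le_rpow (abs_nonneg _) (abs_add_le _ _) (by linarith)).trans
      (add_rpow_le_two (by linarith) (abs_nonneg _) (abs_nonneg _))
  · refine Integrable.mono' ((hu.2.2.add hv.2.2).const_mul (2 ^ p))
      (Measurable.aestronglyMeasurable (by fun_prop)) (Eventually.of_forall fun z => ?_)
    rw [Real.norm_eq_abs, abs_of_nonneg (by positivity)]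
    have h1 : |u z.1 + v z.1 - (u z.2 + v z.2)| ^ p ≤ 2 ^ p * (|u z.1 - u z.2| ^ p + |v z.1 - v z.2| ^ p) := by
      rw [show u z.1 + v z.1 - (u z.2 + v z.2) = (u z.1 - u z.2) + (v z.1 - v z.2) by ring]
      exact (Real.rpow_le_rpow (abs_nonneg _) (abs_add_le _ _) (by linarith)).trans
        (add_rpow_le_two (by linarith) (abs_nonneg _) (abs_nonneg _))
    simp only [Pi.add_apply]
    rw [← add_div, ← mul_div_assoc]
    exact div_le_div_of_nonneg_right h1 (by positivity)

lemma memW_neg {n : ℕ} {s p : ℝ} {D : Set (Euc n)} {u : Euc n → ℝ} (hu : MemW n s p D u) :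
    MemW n s p D (fun x => - u x) := by
  refine ⟨hu.1.neg, ?_, ?_⟩
  · simpa only [abs_neg] using hu.2.1
  · refine hu.2.2.congr (Eventually.of_forall fun z => ?_)
    have : |-u z.1 - -u z.2| = |u z.1 - u z.2| := by rw [← abs_neg]; congr 1; ring
    simp only [this]

lemma exists_meas {n : ℕ} {s p : ℝ} {Ω Ω' : Set (Euc n)} (hΩ' : MeasurableSet Ω') (hsub : Ω ⊆ Ω') {g u : Euc n → ℝ}
    (hgt : MemTail n s p g) (hu : MemW n s p Ω' u) (hug : ∀ᵐ x, x ∉ Ω → u x = g x) :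
    ∃ u0 : Euc n → ℝ, Measurable u0 ∧ ∀ᵐ x, u x = u0 x := by
  have h1 : AEMeasurable u (volume.restrict Ω'ᶜ) := by
    refine (hgt.1.restrict (s := Ω'ᶜ)).congr ?_
    rw [EventuallyEq, ae_restrict_iff' hΩ'.compl]
    filter_upwards [hug] with x hx hxΩ
    exact (hx fun h => hxΩ (hsub h)).symm
  have h2 : AEMeasurable u volume := by
    have := aemeasurable_union_iff.2 ⟨hu.1, h1⟩
    rwa [Set.union_compl_self, Measure.restrict_univ] at this
  exact ⟨h2.mk u, h2.measurable_mk, h2.ae_eq_mk⟩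

lemma tail_u {n : ℕ} {s p : ℝ} (hs0 : 0 < s) (hp : 1 < p) {Ω Ω' : Set (Euc n)} (hΩ' : MeasurableSet Ω')
    (hb : Bornology.IsBounded Ω') (hsub : Ω ⊆ Ω') {g u : Euc n → ℝ} (hum : Measurable u)
    (hgt : MemTail n s p g) (hu : MemW n s p Ω' u) (hug : ∀ᵐ x, x ∉ Ω → u x = g x) (x0 : Euc n) {r : ℝ} (hr : 0 < r) :
    IntegrableOn (fun y => |u y| ^ (p-1) * ‖y - x0‖ ^ (-((n:ℝ) + s * p))) (ball x0 r)ᶜ volume := by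
  have hBm : MeasurableSet (ball x0 r)ᶜ := measurableSet_ball.compl
  have hm : Measurable (fun y : Euc n => |u y| ^ (p-1) * ‖y - x0‖ ^ (-((n:ℝ) + s * p))) := by fun_prop
  have h1 : IntegrableOn (fun y => |u y| ^ (p-1) * ‖y - x0‖ ^ (-((n:ℝ) + s * p))) ((ball x0 r)ᶜ ∩ Ω') volume := by
    refine Integrable.mono' (((int_sub_pow hb hum hu (q := p - 1) (by linarith) (by linarith)).mono_set
      (Set.inter_subset_right (s := (ball x0 r)ᶜ))).const_mul (r ^ (-((n:ℝ) + s * p)))) hm.aestronglyMeasurable ?_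
    rw [ae_restrict_iff' (hBm.inter hΩ')]
    refine Eventually.of_forall fun y hy => ?_
    have hy1 : r ≤ ‖y - x0‖ := by simpa [dist_eq_norm] using hy.1
    rw [Real.norm_eq_abs, abs_of_nonneg (by positivity), mul_comm]
    refine mul_le_mul_of_nonneg_right (Real.rpow_le_rpow_of_nonpos hr hy1 ?_) (by positivity)
    have : 0 ≤ (n:ℝ) + s * p := by positivity
    linarith
  have h2 : IntegrableOn (fun y => |u y| ^ (p-1) * ‖y - x0‖ ^ (-((n:ℝ) + s * p))) ((ball x0 r)ᶜ ∩ Ω'ᶜ) volume := by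
    refine ((hgt.2.2 x0 r hr).mono_set Set.inter_subset_left).congr ?_
    rw [EventuallyEq, ae_restrict_iff' (hBm.inter hΩ'.compl)]
    filter_upwards [hug] with x hx hxΩ
    rw [hx fun h => hxΩ.2 (hsub h)]
  have := h1.union h2
  rwa [Set.inter_union_compl] at this

lemma tail_affine {n : ℕ} {s p : ℝ} (hs0 : 0 < s) (hp : 1 < p) {u : Euc n → ℝ} (hum : Measurable u) {x0 : Euc n} {r : ℝ} (hr : 0 < r)
    (h : IntegrableOn (fun y => |u y| ^ (p-1) * ‖y - x0‖ ^ (-((n:ℝ) + s * p))) (ball x0 r)ᶜ volume)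
    {σ : ℝ} (hσ : |σ| = 1) (k : ℝ) :
    IntegrableOn (fun y => |σ * u y - k| ^ (p-1) * ‖y - x0‖ ^ (-((n:ℝ) + s * p))) (ball x0 r)ᶜ volume := by
  refine Integrable.mono' ((h.add ((int_far hs0 hp x0 hr).const_mul (|k| ^ (p-1)))).const_mul (2 ^ (p-1)))
    (Measurable.aestronglyMeasurable (by fun_prop)) (Eventually.of_forall fun y => ?_)
  rw [Real.norm_eq_abs, abs_of_nonneg (by positivity)]
  have h1 : |σ * u y - k| ^ (p-1) ≤ 2 ^ (p-1) * (|u y| ^ (p-1) + |k| ^ (p-1)) := by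
    refine (Real.rpow_le_rpow (abs_nonneg _) (abs_sub _ _) (by linarith)).trans ?_
    rw [abs_mul, hσ, one_mul]
    exact add_rpow_le_two (by linarith) (abs_nonneg _) (abs_nonneg _)
  calc _ ≤ 2 ^ (p-1) * (|u y| ^ (p-1) + |k| ^ (p-1)) * ‖y - x0‖ ^ (-((n:ℝ) + s * p)) :=
        mul_le_mul_of_nonneg_right h1 (by positivity)
    _ = _ := by simp only [Pi.add_apply]; ring

/-- the solution is a sub-solution above the obstacle and a super-solution everywhere -/
lemma sub0_of_solves
    {n : ℕ} {s p Λ : ℝ} (hn : 1 ≤ n) (hs0 : 0 < s) (hs1 : s < 1) (hp : 1 < p)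
    (hΛ : 1 ≤ Λ) {K : Euc n → Euc n → ℝ} (hK : IsKernel n s p Λ K)
    {Ω Ω' : Set (Euc n)} (hΩo : IsOpen Ω) (hΩ'o : IsOpen Ω')
    (hΩ'b : Bornology.IsBounded Ω') (hsub : Ω ⊆ Ω')
    {g : Euc n → ℝ} {h : Euc n → EReal} (hgt : MemTail n s p g)
    {hR : Euc n → ℝ} (hval : ∀ x ∈ Ω, h x = ((hR x : ℝ) : EReal))
    {u : Euc n → ℝ} (hu : SolvesObstacle n s p Ω Ω' g h K u)
    {u0 : Euc n → ℝ} (hu0 : Measurable u0) (huu : ∀ᵐ x, u x = u0 x)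
    {x0 : Euc n} {r : ℝ} (hball : ball x0 r ⊆ Ω) {σ k : ℝ} (hσ : σ = -1 ∨ (σ = 1 ∧ ∀ x ∈ ball x0 r, hR x ≤ k)) :
    Sub0 n p K (fun x => σ * u0 x - k) x0 r := by
  intro η ρ l hρ hρr hl hη0 hη1 hηs
  have hσ1 : |σ| = 1 := by rcases hσ with h | h <;> simp [h]
  have hσ2 : σ * σ = 1 := by rcases hσ with h | h <;> simp [h]
  obtain ⟨⟨huW, huh, hug⟩, hvar⟩ := hu
  have hu0W := memW_congr huu huW
  have hu0g : ∀ᵐ x, x ∉ Ω → u0 x = g x := by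
    filter_upwards [huu, hug] with x h1 h2 h3
    rw [← h1, h2 h3]
  have hr : 0 < r := hρ.trans hρr
  set w : Euc n → ℝ := fun x => σ * u0 x - k with hw
  have hwm : Measurable w := by fun_prop
  have hwW : MemW n s p Ω' w := memW_affine hp hΩ'b hu0 hσ1 k hu0W
  have hwt := tail_affine hs0 hp hu0 hr (tail_u hs0 hp hΩ'o.measurableSet hΩ'b hsub hu0 hgt hu0W hu0g x0 hr) hσ1 k
  set φ : Euc n → ℝ := fun x => η x ^ p * max (w x) 0 with hφ
  have hηm : Measurable η := hl.continuous.measurable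
  have hφm : Measurable φ := by fun_prop
  have hφW : MemW n s p Ω' φ := memW_phi hn hs1 hp hΩ'o.measurableSet hΩ'b hwm hwW hl hη0 hη1
  have hφs : ∀ x, x ∉ ball x0 ρ → φ x = 0 := by
    intro x hx
    simp only [hφ, hηs x hx]
    rw [Real.zero_rpow (by linarith), zero_mul]
  have hη1' : ∀ x, η x ^ p ≤ 1 := fun x => Real.rpow_le_one (hη0 x) (hη1 x) (by linarith)
  have hη0' : ∀ x, 0 ≤ η x ^ p := fun x => Real.rpow_nonneg (hη0 x) _
  have hφ0 : ∀ x, 0 ≤ φ x := fun x => mul_nonneg (hη0' x) (le_max_right _ _)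
  have hφw : ∀ x, |φ x| ≤ |w x| := by
    intro x
    rw [abs_of_nonneg (hφ0 x)]
    calc φ x ≤ 1 * |w x| := mul_le_mul (hη1' x) (max_le (le_abs_self _) (abs_nonneg _)) (le_max_right _ _) zero_le_one
      _ = _ := one_mul _
  have hI := int_F hs0 hp hΛ hK hΩ'o.measurableSet hΩ'b hwm hwW hρ hρr (hball.trans hsub) hwt hφm hφW hφs hφw
  refine ⟨hI, ?_⟩
  have hφΩ : ∀ x, x ∉ Ω → φ x = 0 := fun x hx => hφs x fun h' => hx (hball (ball_subset_ball hρr.le h'))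
  have hsφW : MemW n s p Ω' (fun x => -(σ * φ x)) := by
    have := memW_affine hp hΩ'b hφm (σ := -σ) (by rwa [abs_neg]) 0 hφW
    simpa using this
  have hv : (fun x => u x + (-(σ * φ x))) ∈ obstacleSet n s p Ω Ω' g h := by
    refine ⟨?_, ?_, ?_⟩
    · refine memW_congr (u := fun x => u0 x + (-(σ * φ x))) ?_ (memW_add hp hu0 (by fun_prop) hu0W hsφW)
      filter_upwards [huu] with x hx
      rw [hx]
    · filter_upwards [huu, huh] with x hx hxh hxΩ
      have h1 := hxh hxΩ
      rw [hval x hxΩ, EReal.coe_le_coe_iff] at h1 ⊢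
      rcases hσ with h | ⟨h, hk⟩
      · rw [h]; linarith [hφ0 x]
      · by_cases hxb : x ∈ ball x0 ρ
        · have h2 := hk x (ball_subset_ball hρr.le hxb)
          rw [hx] at h1 ⊢
          simp only [hφ, hw, h, one_mul]
          rcases le_total (u0 x) k with h3 | h3
          · rw [max_eq_right (by linarith)]; simpa using h1
          · rw [max_eq_left (by linarith)]
            nlinarith [hη1' x]
        · rw [hφs x hxb]; simpa using h1
    · filter_upwards [hug] with x hx hxΩ
      rw [hφΩ x hxΩ, hx hxΩ]; simp
  have h3 := hvar _ hv
  simp only [add_sub_cancel_left] at h3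
  have hLf : ∀ a b, Lf p (σ * a - k) (σ * b - k) = σ * Lf p a b := by
    intro a b
    rw [Lf_sub]
    simp only [Lf, ← mul_sub, abs_mul, hσ1, one_mul]; ring
  have hE : ∀ z : Euc n × Euc n, Lf p (u0 z.1) (u0 z.2) * (-(σ * φ z.1) - -(σ * φ z.2)) * K z.1 z.2 =
      - (Lf p (w z.1) (w z.2) * (φ z.1 - φ z.2) * K z.1 z.2) := by
    intro z
    simp only [hw, hLf]; ring
  have h4 := Aop_eq (p := p) (φ := fun x => -(σ * φ x)) hK.2.1 hΩo.measurableSet hΩ'o.measurableSet hsub huu hug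
    (fun x hx => by simp [hφΩ x hx]) (by simp only [hE]; exact hI.neg)
  rw [h4] at h3
  simp only [hE] at h3
  rw [integral_neg] at h3
  linarith

lemma tl_le_int {n : ℕ} {s p : ℝ} (hp : 1 < p) {f : Euc n → ℝ} {x0 : Euc n} {r : ℝ}
    (h : IntegrableOn (fun y => |f y| ^ (p-1) * ‖y - x0‖ ^ (-((n:ℝ) + s * p))) (ball x0 r)ᶜ volume) :
    ∃ T : ℝ, 0 ≤ T ∧ tl n s p f x0 r ≤ ENNReal.ofReal T := by
  refine ⟨∫ y in (ball x0 r)ᶜ, |f y| ^ (p-1) * ‖y - x0‖ ^ (-((n:ℝ) + s * p)), integral_nonneg fun y => by positivity, ?_⟩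
  rw [ofReal_integral_eq_lintegral_ofReal h (Eventually.of_forall fun y => by positivity), tl]
  refine lintegral_mono fun y => ENNReal.ofReal_le_ofReal ?_
  refine mul_le_mul_of_nonneg_right ?_ (by positivity)
  exact Real.rpow_le_rpow (le_max_right _ _) (max_le (le_abs_self _) (abs_nonneg _)) (by linarith)

lemma bdd_local {n : ℕ} {s p Λ : ℝ} (hn : 1 ≤ n) (hs0 : 0 < s) (hs1 : s < 1) (hp : 1 < p)
    (hΛ : 1 ≤ Λ) {K : Euc n → Euc n → ℝ} (hK : IsKernel n s p Λ K) {f : Euc n → ℝ} (hf : Measurable f)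
    {x0 : Euc n} {r : ℝ} (hr : 0 < r) (hS : ∀ k, 0 ≤ k → Sub0 n p K (fun x => f x - k) x0 r)
    (ht : IntegrableOn (fun y => |f y| ^ (p-1) * ‖y - x0‖ ^ (-((n:ℝ) + s * p))) (ball x0 (r/2))ᶜ volume)
    (hI : IntegrableOn (fun y => |f y| ^ p) (ball x0 r) volume) :
    ∃ d : ℝ, ∀ᵐ x, x ∈ ball x0 (r/2) → f x ≤ d := by
  obtain ⟨ν, hν, hB⟩ := lemB hn hs0 hs1 hp hΛ 1 zero_le_one
  obtain ⟨T, hT0, hT⟩ := tl_le_int hp ht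
  set I := ∫ y in ball x0 r, |f y| ^ p with hId
  have e1 : ∀ᶠ d : ℝ in atTop, T * r ^ (s*p) ≤ d ^ (p-1) :=
    (tendsto_rpow_atTop (by linarith : 0 < p - 1)).eventually_ge_atTop _
  have e2 : ∀ᶠ d : ℝ in atTop, I / (ν * r ^ (n:ℝ)) ≤ d ^ p :=
    (tendsto_rpow_atTop (by linarith : 0 < p)).eventually_ge_atTop _
  obtain ⟨d, ⟨h1, h2⟩, hd⟩ := ((e1.and e2).and (eventually_gt_atTop (0:ℝ))).exists
  refine ⟨d, hB K hK f hf x0 r d hr hd hS ?_ ?_⟩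
  · refine hT.trans (ENNReal.ofReal_le_ofReal ?_)
    have hr1 : 0 < r ^ (s*p) := by positivity
    rw [Real.rpow_neg hr.le, one_mul, ← div_eq_mul_inv, le_div_iff₀ hr1]
    exact h1
  · calc ∫⁻ x in ball x0 r, ENNReal.ofReal (max (f x) 0 ^ p) ≤ ∫⁻ x in ball x0 r, ENNReal.ofReal (|f x| ^ p) :=
          lintegral_mono fun x => ENNReal.ofReal_le_ofReal
            (Real.rpow_le_rpow (le_max_right _ _) (max_le (le_abs_self _) (abs_nonneg _)) (by linarith))
      _ = ENNReal.ofReal I := (ofReal_integral_eq_lintegral_ofReal hI (Eventually.of_forall fun y => by positivity)).symm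
      _ ≤ _ := by
          apply ENNReal.ofReal_le_ofReal
          rw [div_le_iff₀ (by positivity)] at h2
          linarith

/-- one-sided reduction at all small scales -/
lemma osc_step {n : ℕ} {s p Λ : ℝ} (hn : 1 ≤ n) (hs0 : 0 < s) (hs1 : s < 1) (hp : 1 < p) (hΛ : 1 ≤ Λ) :
    ∃ θ : ℝ, 0 < θ ∧ θ ≤ 1/4 ∧ ∀ (K : Euc n → Euc n → ℝ), IsKernel n s p Λ K → ∀ f : Euc n → ℝ, Measurable f →
      ∀ (x0 : Euc n) (R ω : ℝ), 0 < R → 0 < ω → (∀ k, 0 ≤ k → Sub0 n p K (fun x => f x - k) x0 R) →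
      (∀ᵐ x, x ∈ ball x0 R → f x ≤ θ * ω) →
      IntegrableOn (fun y => |f y| ^ (p-1) * ‖y - x0‖ ^ (-((n:ℝ) + s * p))) (ball x0 R)ᶜ volume →
      ∀ᶠ r in 𝓝[>] (0:ℝ), (ENNReal.ofReal (r^(n:ℝ) * vb n / 2) ≤ volume (ball x0 r ∩ {x | f x ≤ -ω/4})) →
        ∀ᵐ x, x ∈ ball x0 (r/2) → f x ≤ θ * ω / 2 := by
  obtain ⟨C, hC, hfar⟩ := far_bound (n := n) (a := (n:ℝ) + s * p) (lt_add_of_pos_right _ (by positivity))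
  set A : ℝ := C * 2 ^ (s*p) + 1 with hA
  have hA0 : 0 ≤ A := by positivity
  obtain ⟨θ, hθ0, hθ1, hD⟩ := lemD hn hs0 hs1 hp hΛ A hA0
  refine ⟨θ, hθ0, hθ1, ?_⟩
  intro K hK f hf x0 R ω hR hω hS hle ht
  obtain ⟨T, hT0, hT⟩ := tl_le_int hp ht
  have hsp : 0 < s * p := by positivity
  have hδ : 0 < (θ * ω) ^ (p-1) := by positivity
  have e1 : ∀ᶠ r in 𝓝[>] (0:ℝ), T * r ^ (s*p) < (θ * ω) ^ (p-1) := by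
    have : Tendsto (fun r : ℝ => T * r ^ (s*p)) (𝓝 0) (𝓝 (T * 0 ^ (s*p))) :=
      (tendsto_id.rpow_const (Or.inr hsp.le)).const_mul T
    rw [Real.zero_rpow hsp.ne', mul_zero] at this
    exact (this.mono_left nhdsWithin_le_nhds).eventually_lt_const hδ
  have e2 : ∀ᶠ r in 𝓝[>] (0:ℝ), r < R/2 := by
    exact (tendsto_id.mono_left nhdsWithin_le_nhds).eventually_lt_const (half_pos hR)
  filter_upwards [e1, e2, self_mem_nhdsWithin] with r h1 h2 hr hvol
  have hr : 0 < r := hr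
  refine hD K hK f hf x0 r ω hr hω (fun k hk => (hS k hk).mono (by linarith))
    (hle.mono fun x hx hxb => hx (ball_subset_ball (by linarith) hxb)) ?_ hvol
  have hsplit : (ball x0 (r/2))ᶜ ⊆ ((ball x0 (r/2))ᶜ ∩ ball x0 R) ∪ (ball x0 R)ᶜ := by
    intro y hy
    by_cases h : y ∈ ball x0 R
    · exact Or.inl ⟨hy, h⟩
    · exact Or.inr h
  have t1 : ∫⁻ y in (ball x0 (r/2))ᶜ ∩ ball x0 R, ENNReal.ofReal (max (f y) 0^(p-1) * ‖y-x0‖^(-((n:ℝ)+s*p))) ≤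
      ENNReal.ofReal ((θ * ω) ^ (p-1) * (C * (r/2) ^ (-(s*p)))) := by
    calc _ ≤ ∫⁻ y in (ball x0 (r/2))ᶜ ∩ ball x0 R, ENNReal.ofReal ((θ * ω) ^ (p-1)) * ENNReal.ofReal (‖y-x0‖^(-((n:ℝ)+s*p))) := by
          apply lintegral_mono_ae
          rw [ae_restrict_iff' (measurableSet_ball.compl.inter measurableSet_ball)]
          filter_upwards [hle] with y hy hyb
          rw [← ENNReal.ofReal_mul hδ.le]
          apply ENNReal.ofReal_le_ofReal
          refine mul_le_mul_of_nonneg_right ?_ (by positivity)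
          exact Real.rpow_le_rpow (le_max_right _ _) (max_le (hy hyb.2) (by positivity)) (by linarith)
      _ ≤ ∫⁻ y in (ball x0 (r/2))ᶜ, ENNReal.ofReal ((θ * ω) ^ (p-1)) * ENNReal.ofReal (‖y-x0‖^(-((n:ℝ)+s*p))) :=
          lintegral_mono_set Set.inter_subset_left
      _ = ENNReal.ofReal ((θ * ω) ^ (p-1)) * ∫⁻ y in (ball x0 (r/2))ᶜ, ENNReal.ofReal (‖y-x0‖^(-((n:ℝ)+s*p))) :=
          lintegral_const_mul' _ _ ENNReal.ofReal_ne_top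
      _ ≤ _ := by
          rw [ENNReal.ofReal_mul hδ.le]
          refine mul_le_mul_right ?_ _
          have := hfar x0 (r/2) (by linarith)
          rwa [show (n:ℝ) - ((n:ℝ) + s * p) = -(s*p) by ring] at this
  calc tl n s p f x0 (r/2) ≤ _ := lintegral_mono_set hsplit
    _ ≤ _ := lintegral_union_le _ _ _
    _ ≤ ENNReal.ofReal ((θ * ω) ^ (p-1) * (C * (r/2) ^ (-(s*p)))) + ENNReal.ofReal T := add_le_add t1 hT
    _ ≤ _ := by
        rw [← ENNReal.ofReal_add (by positivity) hT0]
        apply ENNReal.ofReal_le_ofReal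
        have hrr : 0 < r ^ (s*p) := by positivity
        have h3 : T ≤ (θ * ω) ^ (p-1) * r ^ (-(s*p)) := by
          rw [Real.rpow_neg hr.le, ← div_eq_mul_inv, le_div_iff₀ hrr]; exact h1.le
        have h4 : (r/2) ^ (-(s*p)) = r ^ (-(s*p)) * 2 ^ (s*p) := by
          rw [Real.div_rpow hr.le (by norm_num), Real.rpow_neg (by norm_num : (0:ℝ) ≤ 2), div_inv_eq_mul]
        rw [h4, hA]
        linarith

lemma osc_main {n : ℕ} {s p Λ : ℝ} (hn : 1 ≤ n) (hs0 : 0 < s) (hs1 : s < 1) (hp : 1 < p)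
    (hΛ : 1 ≤ Λ) {K : Euc n → Euc n → ℝ} (hK : IsKernel n s p Λ K)
    {Ω Ω' : Set (Euc n)} (hΩo : IsOpen Ω) (hsub : Ω ⊆ Ω')
    {hR : Euc n → ℝ} (hcont : ContinuousOn hR Ω) {u0 : Euc n → ℝ} (hu0 : Measurable u0)
    (hS : ∀ (x0 : Euc n) (r σ k : ℝ), ball x0 r ⊆ Ω → (σ = -1 ∨ (σ = 1 ∧ ∀ x ∈ ball x0 r, hR x ≤ k)) →
      Sub0 n p K (fun x => σ * u0 x - k) x0 r)
    (hT : ∀ (x0 : Euc n) (r σ k : ℝ), 0 < r → |σ| = 1 →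
      IntegrableOn (fun y => |σ * u0 y - k| ^ (p-1) * ‖y - x0‖ ^ (-((n:ℝ) + s * p))) (ball x0 r)ᶜ volume)
    (hI : ∀ σ k : ℝ, |σ| = 1 → IntegrableOn (fun y => |σ * u0 y - k| ^ p) Ω' volume)
    (hobs : ∀ᵐ x, x ∈ Ω → hR x ≤ u0 x) (x0 : Euc n) (hx0 : x0 ∈ Ω) (ε : ℝ) (hε : 0 < ε) :
    ∃ r c : ℝ, 0 < r ∧ ball x0 r ⊆ Ω ∧ ∀ᵐ x, x ∈ ball x0 r → |u0 x - c| ≤ ε := by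
  -- control of the obstacle near the point
  have hnear : ∀ δ > 0, ∃ R > 0, ball x0 R ⊆ Ω ∧ ∀ x ∈ ball x0 R, |hR x - hR x0| < δ := by
    intro δ hδ
    have h1 := Metric.continuousAt_iff.1 (hcont.continuousAt (hΩo.mem_nhds hx0)) δ hδ
    obtain ⟨R1, hR1, h1⟩ := h1
    obtain ⟨R2, hR2, h2⟩ := Metric.isOpen_iff.1 hΩo x0 hx0
    refine ⟨min R1 R2, lt_min hR1 hR2, (ball_subset_ball (min_le_right _ _)).trans h2, fun x hx => ?_⟩
    have := h1 (lt_of_lt_of_le (mem_ball.1 hx) (min_le_left _ _))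
    rwa [Real.dist_eq] at this
  have habs1 : |(1:ℝ)| = 1 := abs_one
  have habs2 : |(-1:ℝ)| = 1 := by simp
  have hshift : ∀ (R σ k0 : ℝ), ball x0 R ⊆ Ω → (σ = -1 ∨ (σ = 1 ∧ ∀ x ∈ ball x0 R, hR x ≤ k0)) →
      ∀ k, 0 ≤ k → Sub0 n p K (fun x => (fun y => σ * u0 y - k0) x - k) x0 R := by
    intro R σ k0 hb hσ k hk
    have := hS x0 R σ (k0 + k) hb (hσ.imp_right fun h => ⟨h.1, fun x hx => (h.2 x hx).trans (by linarith)⟩)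
    simpa only [sub_sub] using this
  set S : Set ℝ := {t | 0 ≤ t ∧ ∃ r m : ℝ, 0 < r ∧ ball x0 r ⊆ Ω ∧ ∀ᵐ x, x ∈ ball x0 r → m ≤ u0 x ∧ u0 x ≤ m + t} with hSd
  have hSb : BddBelow S := ⟨0, fun t ht => ht.1⟩
  have hpt : ∀ {r : ℝ} {P : Euc n → Prop}, 0 < r → (∀ᵐ x, x ∈ ball x0 r → P x) → ∃ x, x ∈ ball x0 r ∧ P x := by
    intro r P hr h
    by_contra hcon
    push Not at hcon
    have h0 : volume (ball x0 r) = 0 := by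
      refine measure_mono_null ?_ (ae_iff.1 h)
      intro x hx h'
      exact hcon x hx (h' hx)
    exact (measure_ball_pos volume x0 hr).ne' h0
  have hSne : S.Nonempty := by
    obtain ⟨R, hRp, hRb, hRh⟩ := hnear 1 one_pos
    have hk0 : ∀ x ∈ ball x0 R, hR x ≤ hR x0 + 1 := fun x hx => by
      have := (abs_lt.1 (hRh x hx)).2; linarith
    obtain ⟨d1, h1⟩ := bdd_local hn hs0 hs1 hp hΛ hK (f := fun y => 1 * u0 y - (hR x0 + 1)) (by fun_prop) hRp
      (hshift R 1 _ hRb (Or.inr ⟨rfl, hk0⟩)) (hT x0 (R/2) 1 _ (half_pos hRp) habs1) ((hI 1 _ habs1).mono_set (hRb.trans hsub))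
    obtain ⟨d2, h2⟩ := bdd_local hn hs0 hs1 hp hΛ hK (f := fun y => (-1) * u0 y - 0) (by fun_prop) hRp
      (hshift R (-1) _ hRb (Or.inl rfl)) (hT x0 (R/2) (-1) _ (half_pos hRp) habs2) ((hI (-1) _ habs2).mono_set (hRb.trans hsub))
    have h3 : ∀ᵐ x, x ∈ ball x0 (R/2) → -d2 ≤ u0 x ∧ u0 x ≤ hR x0 + 1 + d1 := by
      filter_upwards [h1, h2] with x a1 a2 hx
      have := a1 hx
      have := a2 hx
      constructor <;> linarith
    obtain ⟨y, _, hy1, hy2⟩ := hpt (half_pos hRp) h3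
    refine ⟨hR x0 + 1 + d1 + d2, by linarith, R/2, -d2, half_pos hRp,
      (ball_subset_ball (by linarith)).trans hRb, ?_⟩
    filter_upwards [h3] with x hx hxb
    refine ⟨(hx hxb).1, ?_⟩
    linarith [(hx hxb).2]
  obtain ⟨θ, hθ0, hθ1, hstep⟩ := osc_step hn hs0 hs1 hp hΛ
  set ω := sInf S with hω
  have hω0 : 0 ≤ ω := le_csInf hSne fun t ht => ht.1
  have hωle : ∀ t ∈ S, ω ≤ t := fun t ht => csInf_le hSb ht
  rcases hω0.eq_or_lt with h0 | hpos
  · obtain ⟨t, ⟨ht0, r, m, hr, hrb, hm⟩, htε⟩ := exists_lt_of_csInf_lt hSne (show sInf S < ε by rw [← hω, ← h0]; exact hε)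
    refine ⟨r, m, hr, hrb, ?_⟩
    filter_upwards [hm] with x hx hxb
    rw [abs_le]
    constructor <;> linarith [(hx hxb).1, (hx hxb).2]
  exfalso
  have hθω : 0 < θ * ω := by positivity
  have hθω4 : θ * ω ≤ 1/4 * ω := mul_le_mul_of_nonneg_right hθ1 hpos.le
  obtain ⟨t, ⟨ht0, r1, m, hr1, hr1b, hm⟩, htω⟩ := exists_lt_of_csInf_lt hSne (show sInf S < ω + θ * ω / 2 by linarith)
  obtain ⟨R2, hR2, hR2b, hR2h⟩ := hnear (ω/16) (by linarith)
  set R := min r1 R2 with hRd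
  have hRp : 0 < R := lt_min hr1 hR2
  have hRb : ball x0 R ⊆ Ω := (ball_subset_ball (min_le_left _ _)).trans hr1b
  have hmR : ∀ᵐ x, x ∈ ball x0 R → m ≤ u0 x ∧ u0 x ≤ m + t := by
    filter_upwards [hm] with x hx hxb
    exact hx (ball_subset_ball (min_le_left _ _) hxb)
  have hhR : ∀ x ∈ ball x0 R, |hR x - hR x0| < ω/16 := fun x hx => hR2h x (ball_subset_ball (min_le_right _ _) hx)
  have htω' : ω ≤ t := hωle t ⟨ht0, r1, m, hr1, hr1b, hm⟩
  set M := m + t with hM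
  -- obstacle is far below the upper bound
  have hi : ∀ᵐ x, x ∈ ball x0 R → hR x0 - ω/16 ≤ u0 x ∧ u0 x ≤ M := by
    filter_upwards [hmR, hobs] with x h1 h2 hx
    refine ⟨?_, (h1 hx).2⟩
    have := (abs_lt.1 (hhR x hx)).1
    linarith [h2 (hRb hx)]
  have hMi : ω ≤ M - (hR x0 - ω/16) := by
    obtain ⟨y, _, hy1, hy2⟩ := hpt hRp hi
    refine hωle _ ⟨by linarith, R, hR x0 - ω/16, hRp, hRb, ?_⟩
    filter_upwards [hi] with x hx hxb
    refine ⟨(hx hxb).1, ?_⟩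
    linarith [(hx hxb).2]
  have hk0 : ∀ x ∈ ball x0 R, hR x ≤ M - θ * ω := fun x hx => by
    have := (abs_lt.1 (hhR x hx)).2
    linarith
  have s1 := hstep K hK (fun y => 1 * u0 y - (M - θ * ω)) (by fun_prop) x0 R ω hRp hpos
    (hshift R 1 _ hRb (Or.inr ⟨rfl, hk0⟩))
    (by filter_upwards [hmR] with x hx hxb
        linarith [(hx hxb).2]) (hT x0 R 1 _ hRp habs1)
  have s2 := hstep K hK (fun y => (-1) * u0 y - (- m - θ * ω)) (by fun_prop) x0 R ω hRp hpos
    (hshift R (-1) _ hRb (Or.inl rfl))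
    (by filter_upwards [hmR] with x hx hxb
        linarith [(hx hxb).1]) (hT x0 R (-1) _ hRp habs2)
  have s3 : ∀ᶠ r in 𝓝[>] (0:ℝ), r < R := 
    (tendsto_id.mono_left nhdsWithin_le_nhds).eventually_lt_const hRp
  obtain ⟨r, ⟨⟨h1, h2⟩, h3⟩, hr⟩ := (((s1.and s2).and s3).and self_mem_nhdsWithin).exists
  have hr : 0 < r := hr
  have hr2b : ball x0 (r/2) ⊆ ball x0 R := ball_subset_ball (by linarith)
  have hcase : ENNReal.ofReal (r^(n:ℝ) * vb n / 2) ≤ volume (ball x0 r ∩ {x | u0 x ≤ M - ω/2}) ∨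
      ENNReal.ofReal (r^(n:ℝ) * vb n / 2) ≤ volume (ball x0 r ∩ {x | M - ω/2 < u0 x}) := by
    by_contra hcon
    push Not at hcon
    have hv : 0 ≤ r^(n:ℝ) * vb n / 2 := by have := vb_pos n; positivity
    have h4 : volume (ball x0 r) ≤ volume (ball x0 r ∩ {x | u0 x ≤ M - ω/2}) + volume (ball x0 r ∩ {x | M - ω/2 < u0 x}) := by
      refine le_trans (measure_mono ?_) (measure_union_le _ _)
      intro x hx
      rcases le_or_gt (u0 x) (M - ω/2) with h | h
      · exact Or.inl ⟨hx, h⟩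
      · exact Or.inr ⟨hx, h⟩
    have h5 := lt_of_le_of_lt h4 (ENNReal.add_lt_add hcon.1 hcon.2)
    rw [vol_ball hn x0 hr.le, ← ENNReal.ofReal_add hv hv, add_halves] at h5
    exact lt_irrefl _ h5
  have hfin : ∀ m' : ℝ, (∀ᵐ x, x ∈ ball x0 (r/2) → m' ≤ u0 x ∧ u0 x ≤ m' + (t - θ * ω / 2)) → False := by
    intro m' hm'
    have := hωle (t - θ * ω / 2) ⟨by linarith, r/2, m', half_pos hr, hr2b.trans hRb, hm'⟩
    linarith
  rcases hcase with hc | hc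
  · have h6 := h1 (hc.trans (measure_mono (Set.inter_subset_inter_right _ fun x hx => by
      simp only [Set.mem_setOf_eq] at hx ⊢
      linarith)))
    apply hfin m
    filter_upwards [h6, hmR] with x a1 a2 hx
    have b1 := a1 hx
    have b2 := a2 (hr2b hx)
    constructor <;> linarith
  · have h6 := h2 (hc.trans (measure_mono (Set.inter_subset_inter_right _ fun x hx => by
      simp only [Set.mem_setOf_eq] at hx ⊢
      linarith)))
    apply hfin (m + θ * ω / 2)
    filter_upwards [h6, hmR] with x a1 a2 hx
    have b1 := a1 hx
    have b2 := a2 (hr2b hx)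
    constructor <;> linarith

/-- a function with vanishing local essential oscillation has a continuous representative -/
lemma exists_rep {n : ℕ} {Ω : Set (Euc n)} {u0 u : Euc n → ℝ} (huu : ∀ᵐ x, u x = u0 x)
    (hosc : ∀ x0 ∈ Ω, ∀ ε > 0, ∃ r c : ℝ, 0 < r ∧ ball x0 r ⊆ Ω ∧ ∀ᵐ x, x ∈ ball x0 r → |u0 x - c| ≤ ε) :
    ∃ u' : Euc n → ℝ, (∀ᵐ x, u' x = u x) ∧ ContinuousOn u' Ω := by
  classical
  set T : Euc n → Set ℝ := fun y => {τ | ∃ r > 0, ∀ᵐ x, x ∈ ball y r → τ ≤ u0 x} with hTd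
  set v : Euc n → ℝ := fun y => sSup (T y) with hv
  have key : ∀ (x0 : Euc n) (r c ε : ℝ), (∀ᵐ x, x ∈ ball x0 r → |u0 x - c| ≤ ε) → ∀ y ∈ ball x0 r, |v y - c| ≤ ε := by
    intro x0 r c ε hae y hy
    obtain ⟨δ, hδ, hδb⟩ := Metric.isOpen_iff.1 isOpen_ball y hy
    have hmem : c - ε ∈ T y := ⟨δ, hδ, by
      filter_upwards [hae] with x hx hxb
      have := (abs_le.1 (hx (hδb hxb))).1
      linarith⟩
    have hub : ∀ τ ∈ T y, τ ≤ c + ε := by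
      rintro τ ⟨ρ, hρ, hτ⟩
      by_contra hcon
      have h0 : volume (ball y (min ρ δ)) = 0 := by
        refine measure_mono_null ?_ (ae_iff.1 (hae.and hτ))
        rintro x hx ⟨h1, h2⟩
        have b1 := h2 (ball_subset_ball (min_le_left _ _) hx)
        have b2 := (abs_le.1 (h1 (hδb (ball_subset_ball (min_le_right _ _) hx)))).2
        exact hcon (by linarith)
      exact (measure_ball_pos volume y (lt_min hρ hδ)).ne' h0
    rw [abs_le]
    have a1 : c - ε ≤ v y := le_csSup ⟨c + ε, hub⟩ hmem
    have a2 : v y ≤ c + ε := csSup_le ⟨_, hmem⟩ hub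
    constructor <;> linarith
  have hcontv : ContinuousOn v Ω := by
    intro y hy
    apply ContinuousAt.continuousWithinAt
    rw [Metric.continuousAt_iff]
    intro ε hε
    obtain ⟨r, c, hr, hrb, hae⟩ := hosc y hy (ε/4) (by linarith)
    refine ⟨r, hr, fun {x} hx => ?_⟩
    have h1 := abs_le.1 (key y r c _ hae x hx)
    have h2 := abs_le.1 (key y r c _ hae y (mem_ball_self hr))
    rw [Real.dist_eq, abs_lt]
    constructor <;> linarith [h1.1, h1.2, h2.1, h2.2]
  have haeΩ : ∀ᵐ x, x ∈ Ω → v x = u0 x := by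
    have hk : ∀ k : ℕ, ∀ᵐ x, x ∈ Ω → |v x - u0 x| ≤ 2 * (1 / ((k:ℝ) + 1)) := by
      intro k
      have hk0 : 0 < 1 / ((k:ℝ) + 1) := by positivity
      choose! r c hr hrb hae using fun x hx => hosc x hx (1 / ((k:ℝ) + 1)) hk0
      obtain ⟨t, htΩ, htc, htcov⟩ := TopologicalSpace.countable_cover_nhdsWithin (s := Ω) (f := fun x => ball x (r x))
        (fun x hx => mem_nhdsWithin_of_mem_nhds (ball_mem_nhds x (hr x hx)))
      have h1 : ∀ᵐ x, ∀ y ∈ t, x ∈ ball y (r y) → |u0 x - c y| ≤ 1 / ((k:ℝ) + 1) :=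
        (ae_ball_iff htc).2 fun y hy => hae y (htΩ hy)
      filter_upwards [h1] with x hx hxΩ
      obtain ⟨y, hy, hxy⟩ := Set.mem_iUnion₂.1 (htcov hxΩ)
      have b1 := abs_le.1 (hx y hy hxy)
      have b2 := abs_le.1 (key y (r y) (c y) _ (hae y (htΩ hy)) x hxy)
      rw [abs_le]
      constructor <;> linarith [b1.1, b1.2, b2.1, b2.2]
    have h2 : ∀ᵐ x, ∀ k : ℕ, x ∈ Ω → |v x - u0 x| ≤ 2 * (1 / ((k:ℝ) + 1)) := ae_all_iff.2 hk
    filter_upwards [h2] with x hx hxΩ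
    have hlim : Tendsto (fun k : ℕ => 2 * (1 / ((k:ℝ) + 1))) atTop (𝓝 (2 * 0)) :=
      tendsto_one_div_add_atTop_nhds_zero_nat.const_mul 2
    have h3 : |v x - u0 x| ≤ 2 * 0 := ge_of_tendsto' hlim fun k => hx k hxΩ
    have h4 : |v x - u0 x| = 0 := le_antisymm (by linarith) (abs_nonneg _)
    linarith [abs_eq_zero.1 h4]
  refine ⟨fun x => if x ∈ Ω then v x else u x, ?_, ?_⟩
  · filter_upwards [haeΩ, huu] with x h1 h2
    by_cases hx : x ∈ Ω
    · simp only [hx, if_true]; rw [h1 hx, h2]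
    · simp only [hx, if_false]
  · refine hcontv.congr fun x hx => ?_
    simp only [hx, if_true]

/-- Theorem 4.3 (continuity inherited from the obstacle): if the obstacle `h` is real-valued
and continuous in `Ω`, then the solution `u` to the obstacle problem has a representative
which is continuous in `Ω`. -/
theorem obstacle_solution_continuous_interior
    (n : ℕ) (s p Λ : ℝ) (hn : 1 ≤ n) (hs0 : 0 < s) (hs1 : s < 1) (hp : 1 < p)
    (hΛ : 1 ≤ Λ) (K : Euc n → Euc n → ℝ) (hK : IsKernel n s p Λ K)
    (Ω Ω' : Set (Euc n)) (hΩo : IsOpen Ω) (hΩ'o : IsOpen Ω')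
    (hΩb : Bornology.IsBounded Ω) (hΩ'b : Bornology.IsBounded Ω') (hΩΩ' : closure Ω ⊆ Ω')
    (g : Euc n → ℝ) (h : Euc n → EReal)
    (hg : MemW n s p Ω' g) (hgt : MemTail n s p g)
    (hne : (obstacleSet n s p Ω Ω' g h).Nonempty)
    (hR : Euc n → ℝ) (hval : ∀ x ∈ Ω, h x = ((hR x : ℝ) : EReal))
    (hcont : ContinuousOn hR Ω)
    (u : Euc n → ℝ) (hu : SolvesObstacle n s p Ω Ω' g h K u) :
    ∃ u' : Euc n → ℝ, (∀ᵐ x ∂(volume : Measure (Euc n)), u' x = u x) ∧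
      ContinuousOn u' Ω := by
  have hsub : Ω ⊆ Ω' := subset_closure.trans hΩΩ'
  have huO := hu.1
  obtain ⟨huW, huh, hug⟩ := huO
  obtain ⟨u0, hu0, huu⟩ := exists_meas hΩ'o.measurableSet hsub hgt huW hug
  have hu0W := memW_congr huu huW
  have hu0g : ∀ᵐ x, x ∉ Ω → u0 x = g x := by
    filter_upwards [huu, hug] with x h1 h2 h3
    rw [← h1, h2 h3]
  refine exists_rep huu ?_
  intro x0 hx0 ε hε
  refine osc_main hn hs0 hs1 hp hΛ hK hΩo hsub hcont hu0 ?_ ?_ ?_ ?_ x0 hx0 ε hε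
  · intro x0 r σ k hb hσ
    exact sub0_of_solves hn hs0 hs1 hp hΛ hK hΩo hΩ'o hΩ'b hsub hgt hval hu hu0 huu hb hσ
  · intro x0 r σ k hr hσ
    exact tail_affine hs0 hp hu0 hr (tail_u hs0 hp hΩ'o.measurableSet hΩ'b hsub hu0 hgt hu0W hu0g x0 hr) hσ k
  · intro σ k hσ
    exact (memW_affine hp hΩ'b hu0 hσ k hu0W).2.1
  · filter_upwards [huu, huh] with x h1 h2 hx
    have := h2 hx
    rw [hval x hx, EReal.coe_le_coe_iff, h1] at this
    exact this
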